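/- There exists a constant C > 0 such that the following holds. For every directed graph G on a finite vertex set V with arc set E ⊆ V × V, every pair of distinct vertices s, t ∈ V, and every natural number k, there is a finitely supported probability distribution D on subsets A of V × V such that for every minimal st-cut Z of G with |Z| ≤ k, the probability under D that Z is an st-cut of the augmented graph G+A and, moreover, a minimum st-cut of G+A, is at least 2^(−C·(k+2)^4·log(k+2)) (log denoting the natural logarithm). -/

import Mathlib

open scoped Classical

namespace FlowAug

variable {V : Type}

/-- Reachability from `a` to `b` using arcs in `A`. -/
def Reach (A : Set (V × V)) (a b : V) : Prop :=
  Relation.ReflTransGen (fun u v => (u, v) ∈ A) a b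

/-- `Z` is an `st`-cut of the directed graph with arc set `E`. -/
def IsCut (E : Finset (V × V)) (s t : V) (Z : Finset (V × V)) : Prop :=
  Z ⊆ E ∧ ¬ Reach ((E : Set (V × V)) \ (Z : Set (V × V))) s t

/-- A minimal `st`-cut: no proper subset is an `st`-cut. -/
def IsMinimalCut (E : Finset (V × V)) (s t : V) (Z : Finset (V × V)) : Prop :=
  IsCut E s t Z ∧ ∀ Z', Z' ⊂ Z → ¬ IsCut E s t Z'

/-- A minimum `st`-cut: of minimum cardinality among all `st`-cuts. -/
def IsMinCut (E : Finset (V × V)) (s t : V) (Z : Finset (V × V)) : Prop :=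
  IsCut E s t Z ∧ ∀ Z', IsCut E s t Z' → Z.card ≤ Z'.card

/-- `Z ⊆ E` is an `st`-cut of the augmented graph `G + A`. -/
def IsCutAug (E A : Finset (V × V)) (s t : V) (Z : Finset (V × V)) : Prop :=
  Z ⊆ E ∧ ¬ Reach (((E : Set (V × V)) \ (Z : Set (V × V))) ∪ (A : Set (V × V))) s t

/-- A minimum `st`-cut of the augmented graph `G + A`. -/
def IsMinCutAug (E A : Finset (V × V)) (s t : V) (Z : Finset (V × V)) : Prop :=
  IsCutAug E A s t Z ∧ ∀ Z', IsCutAug E A s t Z' → Z.card ≤ Z'.card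

/-- The `s`-side of the cut `Z`: vertices reachable from `s` using arcs of `E \ Z`. -/
def sSide (E : Finset (V × V)) (s : V) (Z : Finset (V × V)) : Set V :=
  {v | Reach ((E : Set (V × V)) \ (Z : Set (V × V))) s v}

/-- A star `st`-cut: every arc of `Z` has tail in the `s`-side and head in the `t`-side. -/
def IsStarCut (E : Finset (V × V)) (s t : V) (Z : Finset (V × V)) : Prop :=
  IsCut E s t Z ∧ ∀ e ∈ Z, e.1 ∈ sSide E s Z ∧ e.2 ∉ sSide E s Z

/-- `A` is compatible with the star `st`-cut `Z`: no arc of `A` goes from the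
`s`-side of `Z` to the `t`-side of `Z`. -/
def Compatible (E : Finset (V × V)) (s : V) (Z A : Finset (V × V)) : Prop :=
  ∀ e ∈ A, e.1 ∈ sSide E s Z → e.2 ∈ sSide E s Z

/-- `core_{G+A}(Z)`: arcs of `Z` whose head reaches `t` via arcs of `(E \ Z) ∪ A`. -/
noncomputable def coreAug (E A Z : Finset (V × V)) (t : V) : Finset (V × V) :=
  Z.filter (fun e =>
    Reach (((E : Set (V × V)) \ (Z : Set (V × V))) ∪ (A : Set (V × V))) e.2 t)

/-- `core(Z)`: arcs of `Z` whose head reaches `t` via arcs of `E \ Z`. -/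
noncomputable def core (E Z : Finset (V × V)) (t : V) : Finset (V × V) :=
  Z.filter (fun e => Reach ((E : Set (V × V)) \ (Z : Set (V × V))) e.2 t)

/-- `δ⁺(X)`: arcs of `E` with tail in `X` and head outside `X`. -/
noncomputable def deltaPlus (E : Finset (V × V)) (X : Set V) : Finset (V × V) :=
  E.filter (fun e => e.1 ∈ X ∧ e.2 ∉ X)

/-- The arcs traversed by a walk given by its list of vertices. -/
def arcsOf (p : List V) : List (V × V) := p.zip p.tail

/-- `p` is a directed path from `s` to `t` using arcs of `A`. -/
def IsPathIn (A : Set (V × V)) (s t : V) (p : List V) : Prop :=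
  p.Chain' (fun u v => (u, v) ∈ A) ∧ p.head? = some s ∧ p.getLast? = some t

/-- The paths `P i` are pairwise arc-disjoint. -/
def ArcDisjoint {lam : ℕ} (P : Fin lam → List V) : Prop :=
  ∀ i j, i ≠ j → ∀ e : V × V, ¬ (e ∈ arcsOf (P i) ∧ e ∈ arcsOf (P j))

/-- An `st`-flow: a family of pairwise arc-disjoint directed `st`-paths in `G`. -/
def IsFlow (E : Finset (V × V)) (s t : V) {lam : ℕ} (P : Fin lam → List V) : Prop :=
  (∀ i, IsPathIn (E : Set (V × V)) s t (P i)) ∧ ArcDisjoint P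

/-- A maximum `st`-flow: the number of paths equals the minimum cardinality of an `st`-cut. -/
def IsMaxFlow (E : Finset (V × V)) (s t : V) {lam : ℕ} (P : Fin lam → List V) : Prop :=
  IsFlow E s t P ∧ ∃ Z, IsMinCut E s t Z ∧ Z.card = lam

/-- Arcs of the residual graph `G^P`. -/
def ResArc (E : Finset (V × V)) {lam : ℕ} (P : Fin lam → List V) (u v : V) : Prop :=
  ((u, v) ∈ E ∧ ∀ i, (u, v) ∉ arcsOf (P i)) ∨ (∃ i, (v, u) ∈ arcsOf (P i))

/-- Reachability in the residual graph `G^P`. -/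
def ResReach (E : Finset (V × V)) {lam : ℕ} (P : Fin lam → List V) : V → V → Prop :=
  Relation.ReflTransGen (ResArc E P)

/-- `G` has proper boundaries: `δ⁺({s})` and `δ⁻({t})` are minimum `st`-cuts
and there is no arc `(s, t)`. -/
def ProperBoundaries [DecidableEq V] (E : Finset (V × V)) (s t : V) : Prop :=
  IsMinCut E s t (E.filter (fun e => e.1 = s)) ∧
  IsMinCut E s t (E.filter (fun e => e.2 = t)) ∧ (s, t) ∉ E

/-- The reachability pattern of `(G, P)` has only self-loops: no residual path
between internal vertices of distinct flow paths. -/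
def OnlySelfLoops (E : Finset (V × V)) (s t : V) {lam : ℕ} (P : Fin lam → List V) : Prop :=
  ∀ i j : Fin lam, i ≠ j → ∀ u ∈ P i, u ≠ s → u ≠ t → ∀ v ∈ P j, v ≠ s → v ≠ t →
    ¬ ResReach E P u v

/-- A bottleneck arc: an arc contained in some minimum `st`-cut. -/
def Bottleneck (E : Finset (V × V)) (s t : V) (e : V × V) : Prop :=
  ∃ Z, IsMinCut E s t Z ∧ e ∈ Z

/-- A witnessing flow for the star `st`-cut `Z` in `G + A`: `|core_{G+A}(Z)|`
`st`-paths in `G + A`, pairwise sharing no arc of `E \ A`, each containing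
exactly one arc of `core_{G+A}(Z)` and no arc of `Z \ core_{G+A}(Z)`. -/
def WitnessingFlow (E A Z : Finset (V × V)) (s t : V) : Prop :=
  ∃ P : Fin (coreAug E A Z t).card → List V,
    (∀ i, IsPathIn ((E : Set (V × V)) ∪ (A : Set (V × V))) s t (P i)) ∧
    (∀ i j, i ≠ j → ∀ e : V × V, e ∈ arcsOf (P i) → e ∈ arcsOf (P j) →
      e ∉ ((E : Set (V × V)) \ (A : Set (V × V)))) ∧
    (∀ i, ∃! e : V × V, e ∈ coreAug E A Z t ∧ e ∈ arcsOf (P i)) ∧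
    (∀ i, ∀ e ∈ arcsOf (P i), e ∈ Z → e ∈ coreAug E A Z t)

/-! ### Submodularity -/

theorem mem_deltaPlus {E : Finset (V × V)} {X : Set V} {e : V × V} :
    e ∈ deltaPlus E X ↔ e ∈ E ∧ e.1 ∈ X ∧ e.2 ∉ X := by
  simp [deltaPlus]

/-- The indicator function of the arcs leaving `X`. -/
noncomputable def leaving (X : Set V) (e : V × V) : ℕ := if e.1 ∈ X ∧ e.2 ∉ X then 1 else 0

theorem card_deltaPlus_eq_sum (E : Finset (V × V)) (X : Set V) :
    (deltaPlus E X).card = ∑ e ∈ E, leaving X e := by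
  rw [deltaPlus, Finset.card_filter]
  rfl

theorem leaving_submodular (X Y : Set V) (e : V × V) :
    leaving (X ∩ Y) e + leaving (X ∪ Y) e ≤ leaving X e + leaving Y e := by
  unfold leaving
  by_cases h1 : e.1 ∈ X <;> by_cases h2 : e.1 ∈ Y <;> by_cases h3 : e.2 ∈ X <;>
    by_cases h4 : e.2 ∈ Y <;> simp [h1, h2, h3, h4]

theorem card_deltaPlus_submodular (E : Finset (V × V)) (X Y : Set V) :
    (deltaPlus E (X ∩ Y)).card + (deltaPlus E (X ∪ Y)).card ≤
      (deltaPlus E X).card + (deltaPlus E Y).card := by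
  simp only [card_deltaPlus_eq_sum, ← Finset.sum_add_distrib]
  exact Finset.sum_le_sum fun e _ => leaving_submodular X Y e

/-- Equality in the submodular inequality forbids arcs between the two differences. -/
theorem fst_mem_of_snd_mem_of_tight {E : Finset (V × V)} {X Y : Set V}
    (h : (deltaPlus E X).card + (deltaPlus E Y).card ≤
      (deltaPlus E (X ∩ Y)).card + (deltaPlus E (X ∪ Y)).card)
    {e : V × V} (he : e ∈ deltaPlus E X) (h2 : e.2 ∈ Y) : e.1 ∈ Y := by
  rw [mem_deltaPlus] at he
  have h' := le_antisymm (card_deltaPlus_submodular E X Y) h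
  simp only [card_deltaPlus_eq_sum, ← Finset.sum_add_distrib] at h'
  rw [Finset.sum_eq_sum_iff_of_le fun e _ => leaving_submodular X Y e] at h'
  by_contra h1
  simpa [leaving, he.2.1, he.2.2, h1, h2] using h' e he.1

/-! ### Lattices of cuts -/

/-- A family of source sides of `st`-cuts of size at least `lam`, closed under union and
intersection. -/
structure IsCutLattice (E : Finset (V × V)) (s t : V) (lam : ℕ) (L : Set (Set V)) : Prop where
  inter_mem : ∀ X ∈ L, ∀ Y ∈ L, X ∩ Y ∈ L
  union_mem : ∀ X ∈ L, ∀ Y ∈ L, X ∪ Y ∈ L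
  source_mem : ∀ X ∈ L, s ∈ X
  sink_notMem : ∀ X ∈ L, t ∉ X
  le_card : ∀ X ∈ L, lam ≤ (deltaPlus E X).card

/-- The members of `L` whose boundary has exactly `lam` arcs. -/
def tightSets (E : Finset (V × V)) (lam : ℕ) (L : Set (Set V)) : Set (Set V) :=
  {X | X ∈ L ∧ (deltaPlus E X).card = lam}

namespace IsCutLattice

variable {E : Finset (V × V)} {s t : V} {lam : ℕ} {L : Set (Set V)}

theorem inter_mem_tightSets (hL : IsCutLattice E s t lam L) {X Y : Set V}
    (hX : X ∈ tightSets E lam L) (hY : Y ∈ tightSets E lam L) : X ∩ Y ∈ tightSets E lam L := by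
  refine ⟨hL.inter_mem _ hX.1 _ hY.1, ?_⟩
  have h1 := hL.le_card _ (hL.inter_mem _ hX.1 _ hY.1)
  have h2 := hL.le_card _ (hL.union_mem _ hX.1 _ hY.1)
  have h3 := card_deltaPlus_submodular E X Y
  have := hX.2
  have := hY.2
  omega

theorem union_mem_tightSets (hL : IsCutLattice E s t lam L) {X Y : Set V}
    (hX : X ∈ tightSets E lam L) (hY : Y ∈ tightSets E lam L) : X ∪ Y ∈ tightSets E lam L := by
  refine ⟨hL.union_mem _ hX.1 _ hY.1, ?_⟩
  have h1 := hL.le_card _ (hL.inter_mem _ hX.1 _ hY.1)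
  have h2 := hL.le_card _ (hL.union_mem _ hX.1 _ hY.1)
  have h3 := card_deltaPlus_submodular E X Y
  have := hX.2
  have := hY.2
  omega

theorem fst_mem_of_snd_mem (hL : IsCutLattice E s t lam L) {X Y : Set V}
    (hX : X ∈ tightSets E lam L) (hY : Y ∈ tightSets E lam L) {e : V × V}
    (he : e ∈ deltaPlus E X) (h2 : e.2 ∈ Y) : e.1 ∈ Y := by
  refine fst_mem_of_snd_mem_of_tight (le_of_eq ?_) he h2
  rw [hX.2, hY.2, (hL.inter_mem_tightSets hX hY).2, (hL.union_mem_tightSets hX hY).2]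

theorem exists_greatest [Finite V] (hL : IsCutLattice E s t lam L)
    (hne : (tightSets E lam L).Nonempty) :
    ∃ X ∈ tightSets E lam L, ∀ Y ∈ tightSets E lam L, Y ⊆ X := by
  obtain ⟨X, hX, hmax⟩ := (tightSets E lam L).toFinite.exists_maximal hne
  exact ⟨X, hX, fun Y hY => Set.subset_union_right.trans
    (hmax (hL.union_mem_tightSets hX hY) Set.subset_union_left)⟩

theorem exists_least [Finite V] (hL : IsCutLattice E s t lam L)
    (hne : (tightSets E lam L).Nonempty) :
    ∃ X ∈ tightSets E lam L, ∀ Y ∈ tightSets E lam L, X ⊆ Y := by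
  obtain ⟨X, hX, hmin⟩ := (tightSets E lam L).toFinite.exists_minimal hne
  exact ⟨X, hX, fun Y hY => (hmin (hL.inter_mem_tightSets hX hY) Set.inter_subset_left).trans
    Set.inter_subset_right⟩

end IsCutLattice

/-! ### Labelling the arcs of tight cuts -/

/-- A decomposition of the boundaries of the tight sets into `lam` linearly ordered sequences of
arcs, each tight set being crossed by exactly one arc of every sequence. -/
structure Labelling (E : Finset (V × V)) (lam : ℕ) (M : Set (Set V)) where
  pos : Fin lam → Set V → ℕ
  arc : Fin lam → ℕ → V × V
  mem_delta : ∀ Y ∈ M, ∀ e, e ∈ deltaPlus E Y ↔ ∃ i, e = arc i (pos i Y)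
  fst_mem : ∀ Y ∈ M, ∀ Y' ∈ M, ∀ i, (arc i (pos i Y)).1 ∈ Y' ↔ pos i Y ≤ pos i Y'
  snd_mem : ∀ Y ∈ M, ∀ Y' ∈ M, ∀ i, (arc i (pos i Y)).2 ∈ Y' ↔ pos i Y < pos i Y'

/-- A maximal chain of tight sets. -/
theorem IsCutLattice.exists_chain [Finite V] {E : Finset (V × V)} {s t : V} {lam : ℕ}
    {L : Set (Set V)} (hL : IsCutLattice E s t lam L) (hne : (tightSets E lam L).Nonempty) :
    ∃ c : ℕ → Set V, Monotone c ∧ (∀ a, c a ∈ tightSets E lam L) ∧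
      (∀ Y ∈ tightSets E lam L, c 0 ⊆ Y) ∧
      (∀ Y ∈ tightSets E lam L, ∃ N, Y ⊆ c N) ∧
      ∀ a, ∀ T ∈ tightSets E lam L, c a ⊆ T → T ⊆ c (a + 1) → T = c a ∨ T = c (a + 1) := by
  set M := tightSets E lam L with hM
  obtain ⟨bot, hbot, hleast⟩ := hL.exists_least hne
  have hstep : ∀ X : M, ∃ X' : M, (X : Set V) ⊆ X' ∧
      (∀ T ∈ M, (X : Set V) ⊆ T → T ⊆ X' → T = X ∨ T = X') ∧
      ((X' : Set V) = X → ∀ T ∈ M, T ⊆ X) := by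
    rintro ⟨X, hX⟩
    by_cases h : {T | T ∈ M ∧ X ⊂ T}.Nonempty
    · obtain ⟨X', hX', hmin⟩ := ({T | T ∈ M ∧ X ⊂ T}).toFinite.exists_minimal h
      refine ⟨⟨X', hX'.1⟩, hX'.2.subset, fun T hT h1 h2 => ?_, fun h' => ?_⟩
      · by_cases hTX : X = T
        · exact Or.inl hTX.symm
        · exact Or.inr (h2.antisymm (hmin ⟨hT, h1.ssubset_of_ne hTX⟩ h2))
      · exact absurd h' hX'.2.ne'
    · refine ⟨⟨X, hX⟩, subset_rfl, fun T _ h1 h2 => Or.inl (h2.antisymm h1), fun _ T hT => ?_⟩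
      by_contra hTX
      exact h ⟨X ∪ T, hL.union_mem_tightSets hX hT, Set.subset_union_left,
        fun h' => hTX (Set.subset_union_right.trans h')⟩
  choose next h1 h2 h3 using hstep
  set c : ℕ → M := fun a => next^[a] ⟨bot, hbot⟩ with hc
  have hsucc : ∀ a, c (a + 1) = next (c a) := fun a => Function.iterate_succ_apply' _ _ _
  have hmono : Monotone fun a => (c a : Set V) :=
    monotone_nat_of_le_succ fun a => by rw [hsucc]; exact h1 _
  refine ⟨fun a => c a, hmono, fun a => (c a).2, hleast, fun Y hY => ?_, fun a T hT => ?_⟩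
  · obtain ⟨n, hn⟩ := WellFoundedGT.monotone_chain_condition ⟨fun a => (c a : Set V), hmono⟩
    have := hn (n + 1) (Nat.le_succ n)
    refine ⟨n, h3 (c n) ?_ Y hY⟩
    rw [← hsucc]
    exact this.symm
  · simp only [hsucc]
    exact h2 _ T hT

/-- Every injective enumeration can be transported to another finset of the same size, keeping
the common elements fixed. -/
theorem exists_transport {α : Type*} {lam : ℕ} {D : Finset α} (hD : D.card = lam)
    {f : Fin lam → α} (hf : Function.Injective f) :
    ∃ g : Fin lam → α, Function.Injective g ∧ (∀ i, g i ∈ D) ∧ ∀ i, f i ∈ D → g i = f i := by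
  obtain ⟨g, hg⟩ := Set.MapsTo.exists_equiv_extend_of_card_eq (α := Fin lam) (t := D)
    (by simp [hD]) (s := {i | f i ∈ D}) (f := f) (fun i hi => hi) hf.injOn
  exact ⟨fun i => g i, Subtype.val_injective.comp g.injective, fun i => (g i).2, hg⟩

theorem surjective_of_injective_of_card {α : Type*} {lam : ℕ} {D : Finset α}
    (hD : D.card = lam) {f : Fin lam → α} (hf : Function.Injective f) (hfD : ∀ i, f i ∈ D)
    {e : α} (he : e ∈ D) : ∃ i, e = f i := by
  have : Finset.univ.image f = D := Finset.eq_of_subset_of_card_le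
    (by simpa [Finset.image_subset_iff] using hfD)
    (by rw [Finset.card_image_of_injective _ hf]; simp [hD])
  rw [← this] at he
  obtain ⟨i, -, hi⟩ := Finset.mem_image.1 he
  exact ⟨i, hi.symm⟩

theorem exists_enumeration {α : Type*} {lam : ℕ} {D : ℕ → Finset α}
    (hD : ∀ a, (D a).card = lam) :
    ∃ f : ℕ → Fin lam → α, (∀ a, Function.Injective (f a)) ∧ (∀ a i, f a i ∈ D a) ∧
      ∀ a i, f a i ∈ D (a + 1) → f (a + 1) i = f a i := by
  have hstep : ∀ a, ∀ f : {f : Fin lam → α // Function.Injective f},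
      ∃ g : {f : Fin lam → α // Function.Injective f}, (∀ i, g.1 i ∈ D a) ∧
        ∀ i, f.1 i ∈ D a → g.1 i = f.1 i := by
    rintro a ⟨f, hf⟩
    obtain ⟨g, hg, h1, h2⟩ := exists_transport (hD a) hf
    exact ⟨⟨g, hg⟩, h1, h2⟩
  choose next h1 h2 using hstep
  let f0 : {f : Fin lam → α // Function.Injective f} :=
    ⟨fun i => ((D 0).equivFin.symm (Fin.cast (hD 0).symm i)).1, fun i j hij => by
      simpa [Subtype.val_inj] using hij⟩
  let f : ℕ → {f : Fin lam → α // Function.Injective f} :=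
    Nat.rec f0 fun a g => next (a + 1) g
  refine ⟨fun a => (f a).1, fun a => (f a).2, fun a i => ?_, fun a i => h2 (a + 1) (f a) i⟩
  cases a with
  | zero => exact ((D 0).equivFin.symm (Fin.cast (hD 0).symm i)).2
  | succ a => exact h1 (a + 1) (f a) i

theorem IsCutLattice.nonempty_labelling [Finite V] {E : Finset (V × V)} {s t : V} {lam : ℕ}
    {L : Set (Set V)} (hL : IsCutLattice E s t lam L) (hne : (tightSets E lam L).Nonempty) :
    Nonempty (Labelling E lam (tightSets E lam L)) := by
  obtain ⟨c, hmono, hcM, hbot, htop, hatom⟩ := hL.exists_chain hne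
  set M := tightSets E lam L with hM
  obtain ⟨f, hinj, hmem, hkeep⟩ := exists_enumeration fun a => (hcM a).2
  have hfst : ∀ a i, (f a i).1 ∈ c a := fun a i => (mem_deltaPlus.1 (hmem a i)).2.1
  have hsnd : ∀ a i, (f a i).2 ∉ c a := fun a i => (mem_deltaPlus.1 (hmem a i)).2.2
  have hE : ∀ a i, f a i ∈ E := fun a i => (mem_deltaPlus.1 (hmem a i)).1
  have hsurj : ∀ a, ∀ e ∈ deltaPlus E (c a), ∃ i, e = f a i := fun a e he =>
    surjective_of_injective_of_card (hcM a).2 (hinj a) (hmem a) he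
  have persist : ∀ a i b, a ≤ b → (f a i).2 ∉ c b → f b i = f a i := by
    intro a i b hab
    induction b, hab using Nat.le_induction with
    | base => intro _; rfl
    | succ b hab ih =>
      intro h
      have h1 := ih fun h' => h (hmono (Nat.le_succ b) h')
      rw [← h1]
      apply hkeep
      rw [h1]
      exact mem_deltaPlus.2 ⟨hE a i, hmono (hab.trans (Nat.le_succ b)) (hfst a i), h⟩
  have label_le : ∀ a i b j, a ≤ b → f a i = f b j → i = j := by
    intro a i b j hab h
    have := persist a i b hab (h ▸ hsnd b j)
    exact hinj b (this.trans h)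
  have label : ∀ a i b j, f a i = f b j → i = j := by
    intro a i b j h
    rcases le_total a b with hab | hab
    · exact label_le a i b j hab h
    · exact (label_le b j a i hab h.symm).symm
  have status : ∀ Y ∈ M, ∀ a i, (f a i).2 ∈ Y → (f (a + 1) i).1 ∈ Y ∨ f (a + 1) i = f a i := by
    intro Y hY a i h
    rcases hatom a ((Y ∩ c (a + 1)) ∪ c a)
      (hL.union_mem_tightSets (hL.inter_mem_tightSets hY (hcM _)) (hcM a))
      Set.subset_union_right
      (Set.union_subset Set.inter_subset_right (hmono (Nat.le_succ a))) with hT | hT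
    · refine Or.inr (persist a i (a + 1) (Nat.le_succ a) fun h' => hsnd a i ?_)
      rw [← hT]
      exact Or.inl ⟨h, h'⟩
    · have h1 := hfst (a + 1) i
      rw [← hT] at h1
      rcases h1 with h1 | h1
      · exact Or.inl h1.1
      · right
        obtain ⟨j, hj⟩ := hsurj a (f (a + 1) i) (mem_deltaPlus.2 ⟨hE _ _, h1, fun h' =>
          hsnd (a + 1) i (hmono (Nat.le_succ a) h')⟩)
        rw [hj, label _ _ _ _ hj]
  have hex : ∀ Y ∈ M, ∀ i, ∃ a, (f a i).2 ∉ Y := fun Y hY i => by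
    obtain ⟨N, hN⟩ := htop Y hY
    exact ⟨N, fun h => hsnd N i (hN h)⟩
  set pos : Fin lam → Set V → ℕ := fun i Y => sInf {a | (f a i).2 ∉ Y} with hpos
  have hposmem : ∀ Y ∈ M, ∀ i, (f (pos i Y) i).2 ∉ Y := fun Y hY i => Nat.sInf_mem (hex Y hY i)
  have hpos_lt : ∀ Y i a, a < pos i Y → (f a i).2 ∈ Y := fun Y i a h => by
    simpa using Nat.notMem_of_lt_sInf h
  have first_exit : ∀ Y ∈ M, ∀ a i, (f (a + 1) i).2 ∉ Y → (f a i).2 ∈ Y →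
      f (a + 1) i ∈ deltaPlus E Y := by
    intro Y hY a i h1 h2
    rcases status Y hY a i h2 with h | h
    · exact mem_deltaPlus.2 ⟨hE _ _, h, h1⟩
    · exact absurd (h ▸ h2) h1
  have exit : ∀ Y ∈ M, ∀ i, f (pos i Y) i ∈ deltaPlus E Y := by
    intro Y hY i
    have h := hposmem Y hY i
    rcases hp : pos i Y with _ | a
    · rw [hp] at h
      exact mem_deltaPlus.2 ⟨hE _ _, hbot Y hY (hfst 0 i), h⟩
    · rw [hp] at h
      exact first_exit Y hY a i h (hpos_lt Y i a (by omega))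
  have hmd : ∀ Y ∈ M, ∀ e, e ∈ deltaPlus E Y ↔ ∃ i, e = f (pos i Y) i := by
    intro Y hY e
    refine ⟨fun he => surjective_of_injective_of_card hY.2
      (f := fun i => f (pos i Y) i) (fun i j h => label _ _ _ _ h) (exit Y hY) he, ?_⟩
    rintro ⟨i, rfl⟩
    exact exit Y hY i
  have pfx : ∀ Y ∈ M, ∀ i b, pos i Y ≤ b → (f b i).2 ∉ Y := by
    intro Y hY i b hb
    induction b, hb using Nat.le_induction with
    | base => exact hposmem Y hY i
    | succ b hb ih =>
      intro h
      obtain ⟨b', hbb', h1, h2⟩ : ∃ b', b + 1 ≤ b' ∧ (f (b' + 1) i).2 ∉ Y ∧ (f b' i).2 ∈ Y := by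
        by_contra! hno
        have hall : ∀ b', b + 1 ≤ b' → (f b' i).2 ∈ Y := by
          intro b' hb'
          induction b', hb' using Nat.le_induction with
          | base => exact h
          | succ n hn ihn => exact by_contra fun h' => hno n hn h' ihn
        obtain ⟨N, hN⟩ := htop Y hY
        exact hsnd (max N (b + 1)) i
          (hmono (le_max_left _ _) (hN (hall _ (le_max_right _ _))))
      obtain ⟨j, hj⟩ := (hmd Y hY _).1 (first_exit Y hY b' i h1 h2)
      obtain rfl := label _ _ _ _ hj
      have h3 : (f (pos i Y) i).2 ∉ c (b + 1) := by
        rw [← hj]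
        exact fun h' => hsnd (b' + 1) i (hmono (by omega) h')
      have h4 := persist _ _ _ (by omega) h3
      rw [h4] at h
      exact hposmem Y hY i h
  have hsnd_iff : ∀ Y ∈ M, ∀ Y' ∈ M, ∀ i, (f (pos i Y) i).2 ∈ Y' ↔ pos i Y < pos i Y' :=
    fun Y _ Y' hY' i => ⟨fun h => by_contra fun h' => pfx Y' hY' i _ (not_lt.1 h') h,
      hpos_lt Y' i _⟩
  refine ⟨⟨pos, fun i a => f a i, hmd, fun Y hY Y' hY' i => ⟨fun h => ?_, fun h => ?_⟩,
    hsnd_iff⟩⟩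
  · by_contra! hlt
    obtain ⟨j, hj⟩ := (hmd Y' hY' (f (pos i Y) i)).1
      (mem_deltaPlus.2 ⟨hE _ _, h, pfx Y' hY' i _ hlt.le⟩)
    obtain rfl := label _ _ _ _ hj
    exact hposmem Y hY i (hj ▸ hpos_lt Y i _ hlt)
  · rcases h.lt_or_eq with h | h
    · exact hL.fst_mem_of_snd_mem hY hY' (exit Y hY i) ((hsnd_iff Y hY Y' hY' i).2 h)
    · simp only [h]
      exact (mem_deltaPlus.1 (exit Y' hY' i)).2.1

namespace Labelling

variable {E : Finset (V × V)} {s t : V} {lam : ℕ} {L : Set (Set V)}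
  (P : Labelling E lam (tightSets E lam L))

/-- The arc of the `i`-th sequence leaving the tight set `Y`. -/
def ed (i : Fin lam) (Y : Set V) : V × V := P.arc i (P.pos i Y)

variable {P} {Y Y' : Set V} {i : Fin lam}

theorem ed_mem (hY : Y ∈ tightSets E lam L) (i : Fin lam) : P.ed i Y ∈ deltaPlus E Y :=
  (P.mem_delta Y hY _).2 ⟨i, rfl⟩

theorem exists_ed_eq (hY : Y ∈ tightSets E lam L) {e : V × V} (he : e ∈ deltaPlus E Y) :
    ∃ i, e = P.ed i Y :=
  (P.mem_delta Y hY _).1 he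

theorem ed_fst_mem (hY : Y ∈ tightSets E lam L) (hY' : Y' ∈ tightSets E lam L) :
    (P.ed i Y).1 ∈ Y' ↔ P.pos i Y ≤ P.pos i Y' :=
  P.fst_mem Y hY Y' hY' i

theorem ed_snd_mem (hY : Y ∈ tightSets E lam L) (hY' : Y' ∈ tightSets E lam L) :
    (P.ed i Y).2 ∈ Y' ↔ P.pos i Y < P.pos i Y' :=
  P.snd_mem Y hY Y' hY' i

theorem ed_congr (h : P.pos i Y = P.pos i Y') : P.ed i Y = P.ed i Y' := by
  simp only [ed, h]

theorem pos_mono (hY : Y ∈ tightSets E lam L) (hY' : Y' ∈ tightSets E lam L) (h : Y ⊆ Y')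
    (i : Fin lam) : P.pos i Y ≤ P.pos i Y' :=
  (ed_fst_mem hY hY').1 (h ((ed_fst_mem hY hY).2 le_rfl))

theorem pos_union (hL : IsCutLattice E s t lam L) (hY : Y ∈ tightSets E lam L)
    (hY' : Y' ∈ tightSets E lam L) (i : Fin lam) :
    P.pos i (Y ∪ Y') = max (P.pos i Y) (P.pos i Y') := by
  have hU := hL.union_mem_tightSets hY hY'
  refine le_antisymm ?_ (max_le (pos_mono hY hU Set.subset_union_left i)
    (pos_mono hY' hU Set.subset_union_right i))
  rcases (ed_fst_mem (P := P) (i := i) hU hU).2 le_rfl with h | h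
  · exact le_max_of_le_left ((ed_fst_mem hU hY).1 h)
  · exact le_max_of_le_right ((ed_fst_mem hU hY').1 h)

theorem pos_inter (hL : IsCutLattice E s t lam L) (hY : Y ∈ tightSets E lam L)
    (hY' : Y' ∈ tightSets E lam L) (i : Fin lam) :
    P.pos i (Y ∩ Y') = min (P.pos i Y) (P.pos i Y') := by
  have hI := hL.inter_mem_tightSets hY hY'
  refine le_antisymm (le_min (pos_mono hI hY Set.inter_subset_left i)
    (pos_mono hI hY' Set.inter_subset_right i)) ?_
  by_contra! h
  rw [lt_min_iff] at h
  exact (ed_snd_mem (P := P) (i := i) hI hI).not.2 (lt_irrefl _)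
    ⟨(ed_snd_mem hI hY).2 h.1, (ed_snd_mem hI hY').2 h.2⟩

end Labelling

/-- The terminals together with all endpoints of arcs leaving members of `M`. -/
def touched (E : Finset (V × V)) (s t : V) (M : Set (Set V)) : Set V :=
  {v | v = s ∨ v = t ∨ ∃ Y ∈ M, ∃ e ∈ deltaPlus E Y, v = e.1 ∨ v = e.2}

theorem source_mem_touched {E : Finset (V × V)} {s t : V} {M : Set (Set V)} :
    s ∈ touched E s t M := Or.inl rfl

theorem sink_mem_touched {E : Finset (V × V)} {s t : V} {M : Set (Set V)} :
    t ∈ touched E s t M := Or.inr (Or.inl rfl)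

namespace Labelling

variable {E : Finset (V × V)} {s t : V} {lam : ℕ} {L : Set (Set V)}
  {P : Labelling E lam (tightSets E lam L)} {Y Y' : Set V}

theorem ed_fst_mem_touched (hY : Y ∈ tightSets E lam L) (i : Fin lam) :
    (P.ed i Y).1 ∈ touched E s t (tightSets E lam L) :=
  Or.inr (Or.inr ⟨Y, hY, _, ed_mem hY i, Or.inl rfl⟩)

theorem ed_snd_mem_touched (hY : Y ∈ tightSets E lam L) (i : Fin lam) :
    (P.ed i Y).2 ∈ touched E s t (tightSets E lam L) :=
  Or.inr (Or.inr ⟨Y, hY, _, ed_mem hY i, Or.inr rfl⟩)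

theorem inter_touched_subset (hL : IsCutLattice E s t lam L) (hY : Y ∈ tightSets E lam L)
    (hY' : Y' ∈ tightSets E lam L) (h : ∀ i, P.pos i Y ≤ P.pos i Y') :
    Y ∩ touched E s t (tightSets E lam L) ⊆ Y' := by
  rintro v ⟨hv, rfl | rfl | ⟨W, hW, e, he, rfl | rfl⟩⟩
  · exact hL.source_mem _ hY'.1
  · exact absurd hv (hL.sink_notMem _ hY.1)
  · obtain ⟨i, rfl⟩ := exists_ed_eq (P := P) hW he
    exact (ed_fst_mem hW hY').2 (((ed_fst_mem hW hY).1 hv).trans (h i))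
  · obtain ⟨i, rfl⟩ := exists_ed_eq (P := P) hW he
    exact (ed_snd_mem hW hY').2 (((ed_snd_mem hW hY).1 hv).trans_le (h i))

end Labelling

/-! ### Sets generated by a family -/

section Generated

variable {ι : Type*}

/-- On the vertices of `B`, the set `T` belongs to the lattice generated by the sets `X x`,
`x ∈ S`. -/
def IsGenerated (B : Set V) (X : ι → Set V) (S : Finset ι) (T : Set V) : Prop :=
  ∀ u ∈ T, u ∈ B → ∀ v ∈ B, v ∉ T → ∃ x ∈ S, u ∈ X x ∧ v ∉ X x

/-- No member of `M` is generated by the family. -/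
def Kills (B : Set V) (M : Set (Set V)) (X : ι → Set V) (S : Finset ι) : Prop :=
  ∀ T ∈ M, ¬ IsGenerated B X S T

variable {B : Set V} {X : ι → Set V} {S S' : Finset ι} {T : Set V} {M : Set (Set V)}

theorem IsGenerated.mono (h : IsGenerated B X S' T) (hS : S' ⊆ S) : IsGenerated B X S T :=
  fun u hu huB v hvB hv =>
    let ⟨x, hx, h'⟩ := h u hu huB v hvB hv
    ⟨x, hS hx, h'⟩

theorem IsGenerated.clip {s t : V} (h : IsGenerated B X S T) (hs : s ∈ T) (hsB : s ∈ B)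
    (ht : t ∉ T) (htB : t ∈ B) (lo hi : Set V) :
    IsGenerated B (fun x => (X x ∪ lo) ∩ hi) S ((T ∪ lo) ∩ hi) := by
  rintro u ⟨hu | hu, hu'⟩ huB v hvB hv
  · by_cases hv' : v ∈ hi
    · have hv2 : v ∉ T ∪ lo := fun h' => hv ⟨h', hv'⟩
      obtain ⟨x, hx, h1, h2⟩ := h u hu huB v hvB fun h' => hv2 (Or.inl h')
      exact ⟨x, hx, ⟨Or.inl h1, hu'⟩, fun h' => h'.1.elim h2 fun h3 => hv2 (Or.inr h3)⟩
    · obtain ⟨x, hx, h1, h2⟩ := h u hu huB t htB ht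
      exact ⟨x, hx, ⟨Or.inl h1, hu'⟩, fun h' => hv' h'.2⟩
  · by_cases hv' : v ∈ hi
    · have hv2 : v ∉ T ∪ lo := fun h' => hv ⟨h', hv'⟩
      obtain ⟨x, hx, h1, h2⟩ := h s hs hsB v hvB fun h' => hv2 (Or.inl h')
      exact ⟨x, hx, ⟨Or.inr hu, hu'⟩, fun h' => h'.1.elim h2 fun h3 => hv2 (Or.inr h3)⟩
    · obtain ⟨x, hx, h1, h2⟩ := h s hs hsB t htB ht
      exact ⟨x, hx, ⟨Or.inr hu, hu'⟩, fun h' => hv' h'.2⟩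

theorem Kills.of_clip {E : Finset (V × V)} {s t : V} {lam : ℕ} {L : Set (Set V)}
    (hL : IsCutLattice E s t lam L) {lo hi : Set V} (hlo : lo ∈ tightSets E lam L)
    (hhi : hi ∈ tightSets E lam L) (hsB : s ∈ B) (htB : t ∈ B)
    (h : Kills B (tightSets E lam L) (fun x => (X x ∪ lo) ∩ hi) S) :
    Kills B (tightSets E lam L) X S := fun _ hT hg =>
  h _ (hL.inter_mem_tightSets (hL.union_mem_tightSets hT hlo) hhi)
    (hg.clip (hL.source_mem _ hT.1) hsB (hL.sink_notMem _ hT.1) htB lo hi)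

/-- If the layers of a family are nested, a set generated by the whole family is generated by a
single layer. -/
theorem IsGenerated.exists_layer {s t : V} (h : IsGenerated B X S T) (hs : s ∈ T) (hsB : s ∈ B)
    (ht : t ∉ T) (htB : t ∈ B) (g : ι → ℕ)
    (hg : ∀ x ∈ S, ∀ y ∈ S, g x < g y → X x ∩ B ⊆ X y) :
    ∃ n, IsGenerated B X (S.filter fun x => g x = n) T := by
  have hex : ∃ n, ∀ u ∈ T, u ∈ B → ∃ x ∈ S, g x ≤ n ∧ u ∈ X x := by
    refine ⟨S.sup g, fun u hu huB => ?_⟩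
    obtain ⟨x, hx, h1, -⟩ := h u hu huB t htB ht
    exact ⟨x, hx, Finset.le_sup hx, h1⟩
  set n := Nat.find hex with hn
  have hle := Nat.find_spec hex
  rw [← hn] at hle
  obtain ⟨u₀, hu₀, hu₀B, hmin⟩ : ∃ u₀ ∈ T, u₀ ∈ B ∧ ∀ x ∈ S, u₀ ∈ X x → n ≤ g x := by
    rcases Nat.eq_zero_or_pos n with h0 | h0
    · exact ⟨s, hs, hsB, fun x _ _ => by omega⟩
    · have := Nat.find_min hex (m := n - 1) (by omega)
      push Not at this
      obtain ⟨u, hu, huB, hux⟩ := this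
      exact ⟨u, hu, huB, fun x hx hx' => by_contra fun h' => hux x hx (by omega) hx'⟩
  obtain ⟨x₀, hx₀, h1, h2⟩ := hle u₀ hu₀ hu₀B
  have hx₀n : g x₀ = n := le_antisymm h1 (hmin _ hx₀ h2)
  refine ⟨n, fun u hu huB v hvB hv => ?_⟩
  obtain ⟨x₁, hx₁, h3, h4⟩ := hle u hu huB
  obtain ⟨x, hx, h5, h6⟩ := h u hu huB v hvB hv
  obtain ⟨x₂, hx₂, h7, h8⟩ := h u₀ hu₀ hu₀B v hvB hv
  have h9 := hmin _ hx₂ h7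
  by_cases hlow : ∃ z ∈ S, g z < n ∧ u ∈ X z
  · obtain ⟨z, hz, hzn, huz⟩ := hlow
    rcases h9.eq_or_lt with h9 | h9
    · exact ⟨x₂, Finset.mem_filter.2 ⟨hx₂, h9.symm⟩,
        hg z hz x₂ hx₂ (by omega) ⟨huz, huB⟩, h8⟩
    · exact ⟨x₀, Finset.mem_filter.2 ⟨hx₀, hx₀n⟩, hg z hz x₀ hx₀ (by omega) ⟨huz, huB⟩,
        fun h' => h8 (hg x₀ hx₀ x₂ hx₂ (by omega) ⟨h', hvB⟩)⟩
  · push Not at hlow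
    have h10 : n ≤ g x := by_contra fun h' => hlow x hx (by omega) h5
    have h11 : n ≤ g x₁ := by_contra fun h' => hlow x₁ hx₁ (by omega) h4
    rcases h10.eq_or_lt with h10 | h10
    · exact ⟨x, Finset.mem_filter.2 ⟨hx, h10.symm⟩, h5, h6⟩
    · exact ⟨x₁, Finset.mem_filter.2 ⟨hx₁, by omega⟩, h4,
        fun h' => h6 (hg x₁ hx₁ x hx (by omega) ⟨h', hvB⟩)⟩

end Generated

/-! ### Weighted pigeonhole -/

section Pigeonhole

variable {ι : Type*} {w : ι → ℝ}

theorem exists_heavy_class {κ : Type*} [Fintype κ] [Nonempty κ] (hw : ∀ x, 0 ≤ w x)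
    (S : Finset ι) (R : ι → κ → Prop) (h : ∀ x ∈ S, ∃ c, R x c) :
    ∃ c, ∃ S' ⊆ S, (∀ x ∈ S', R x c) ∧ ∑ x ∈ S, w x ≤ Fintype.card κ * ∑ x ∈ S', w x := by
  obtain ⟨c, -, hc⟩ := Finset.exists_max_image (Finset.univ : Finset κ)
    (fun c => ∑ x ∈ S.filter (R · c), w x) Finset.univ_nonempty
  refine ⟨c, S.filter (R · c), Finset.filter_subset _ _,
    fun x hx => (Finset.mem_filter.1 hx).2, ?_⟩
  calc ∑ x ∈ S, w x ≤ ∑ x ∈ S, ∑ c, if R x c then w x else 0 := by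
        refine Finset.sum_le_sum fun x hx => ?_
        obtain ⟨c, hc⟩ := h x hx
        calc w x = if R x c then w x else 0 := by rw [if_pos hc]
          _ ≤ _ := Finset.single_le_sum (f := fun c => if R x c then w x else 0)
            (fun c _ => by split_ifs <;> simp [hw]) (Finset.mem_univ c)
    _ = ∑ c, ∑ x ∈ S.filter (R · c), w x := by
        rw [Finset.sum_comm]
        simp only [Finset.sum_filter]
    _ ≤ ∑ _c : κ, ∑ x ∈ S.filter (R · c), w x := Finset.sum_le_sum fun c' _ => hc c' (by simp)
    _ = _ := by simp

theorem exists_kills_of_layers {B : Set V} {X : ι → Set V} {S : Finset ι} {E : Finset (V × V)}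
    {s t : V} {lam : ℕ} {L : Set (Set V)} (hL : IsCutLattice E s t lam L) (hsB : s ∈ B)
    (htB : t ∈ B) (g : ι → ℕ) (hg : ∀ x ∈ S, ∀ y ∈ S, g x < g y → X x ∩ B ⊆ X y) {K : ℝ}
    (h : ∀ n, ∃ S' ⊆ S.filter (fun x => g x = n), Kills B (tightSets E lam L) X S' ∧
      ∑ x ∈ S.filter (fun x => g x = n), w x ≤ K * ∑ x ∈ S', w x) :
    ∃ S' ⊆ S, Kills B (tightSets E lam L) X S' ∧ ∑ x ∈ S, w x ≤ K * ∑ x ∈ S', w x := by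
  choose S' h1 h2 h3 using h
  have hfil : ∀ n, ((S.filter fun x => x ∈ S' (g x)).filter fun x => g x = n) = S' n := by
    intro n
    ext x
    simp only [Finset.mem_filter]
    constructor
    · rintro ⟨⟨-, h⟩, rfl⟩
      exact h
    · intro h
      have := Finset.mem_filter.1 (h1 n h)
      obtain ⟨hx, rfl⟩ := this
      exact ⟨⟨hx, h⟩, rfl⟩
  refine ⟨S.filter fun x => x ∈ S' (g x), Finset.filter_subset _ _, fun T hT hgen => ?_, ?_⟩
  · obtain ⟨n, hn⟩ := hgen.exists_layer (hL.source_mem _ hT.1) hsB (hL.sink_notMem _ hT.1) htB g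
      fun x hx y hy => hg x (Finset.mem_filter.1 hx).1 y (Finset.mem_filter.1 hy).1
    rw [hfil] at hn
    exact h2 n T hT hn
  · have hS : ∀ x ∈ S, g x ∈ S.image g := fun x hx => Finset.mem_image_of_mem g hx
    rw [← Finset.sum_fiberwise_of_maps_to hS,
      ← Finset.sum_fiberwise_of_maps_to fun x hx => hS x (Finset.mem_filter.1 hx).1,
      Finset.mul_sum]
    refine Finset.sum_le_sum fun n _ => ?_
    rw [hfil]
    exact h3 n

end Pigeonhole

/-! ### Boxes, patterns and fitting sets -/

/-- The tight sets between `lo` and `hi`. -/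
def box (E : Finset (V × V)) (lam : ℕ) (L : Set (Set V)) (lo hi : Set V) : Set (Set V) :=
  {W | W ∈ tightSets E lam L ∧ lo ⊆ W ∧ W ⊆ hi}

/-- `X` is a source side between `lo` and `hi` which behaves, with respect to the tight sets in
between, like the source side of a minimal cut of size at most `k`. -/
structure Fit (E : Finset (V × V)) (s t : V) (lam : ℕ) (L : Set (Set V)) (k : ℕ)
    (lo hi X : Set V) : Prop where
  mem : X ∈ L
  lo_subset : lo ⊆ X
  subset_hi : X ⊆ hi
  card_le : (deltaPlus E X).card ≤ k
  not_subset : ∀ Y ∈ box E lam L lo hi, ¬ deltaPlus E Y ⊆ deltaPlus E X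
  subset_of_snd : ∀ Y ∈ box E lam L lo hi, (∀ e ∈ deltaPlus E Y, e.2 ∉ X) →
    X ∩ touched E s t (tightSets E lam L) ⊆ Y
  subset_of_fst : ∀ Y ∈ box E lam L lo hi, (∀ e ∈ deltaPlus E Y, e.1 ∈ X) →
    Y ∩ touched E s t (tightSets E lam L) ⊆ X

section Box

variable {E : Finset (V × V)} {s t : V} {lam k : ℕ} {L : Set (Set V)}
  {lo hi lo' hi' X Y Z W : Set V}

theorem inter_mem_box (hL : IsCutLattice E s t lam L) (hY : Y ∈ box E lam L lo hi)
    (hZ : Z ∈ box E lam L lo hi) : Y ∩ Z ∈ box E lam L lo hi :=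
  ⟨hL.inter_mem_tightSets hY.1 hZ.1, Set.subset_inter hY.2.1 hZ.2.1,
    Set.inter_subset_left.trans hY.2.2⟩

theorem union_mem_box (hL : IsCutLattice E s t lam L) (hY : Y ∈ box E lam L lo hi)
    (hZ : Z ∈ box E lam L lo hi) : Y ∪ Z ∈ box E lam L lo hi :=
  ⟨hL.union_mem_tightSets hY.1 hZ.1, hY.2.1.trans Set.subset_union_left,
    Set.union_subset hY.2.2 hZ.2.2⟩

theorem box_mono (hlo : lo ⊆ lo') (hhi : hi' ⊆ hi) : box E lam L lo' hi' ⊆ box E lam L lo hi :=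
  fun _ hY => ⟨hY.1, hlo.trans hY.2.1, hY.2.2.trans hhi⟩

theorem IsCutLattice.card_inter_le (hL : IsCutLattice E s t lam L) (hX : X ∈ L)
    (hY : Y ∈ tightSets E lam L) : (deltaPlus E (X ∩ Y)).card ≤ (deltaPlus E X).card := by
  have h1 := card_deltaPlus_submodular E X Y
  have h2 := hL.le_card _ (hL.union_mem _ hX _ hY.1)
  have h3 := hY.2
  omega

theorem IsCutLattice.card_union_le (hL : IsCutLattice E s t lam L) (hX : X ∈ L)
    (hY : Y ∈ tightSets E lam L) : (deltaPlus E (X ∪ Y)).card ≤ (deltaPlus E X).card := by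
  have h1 := card_deltaPlus_submodular E X Y
  have h2 := hL.le_card _ (hL.inter_mem _ hX _ hY.1)
  have h3 := hY.2
  omega

variable (P : Labelling E lam (tightSets E lam L))

/-- The pairs `(j, i)` such that a tight set in the box reaching the top on the `j`-th sequence
has left the bottom on the `i`-th sequence. -/
noncomputable def pattern (lo hi : Set V) : Finset (Fin lam × Fin lam) :=
  Finset.univ.filter fun p => ∀ W ∈ box E lam L lo hi,
    P.pos p.1 W = P.pos p.1 hi → P.pos p.2 lo < P.pos p.2 W

variable {P}

theorem mem_pattern {p : Fin lam × Fin lam} : p ∈ pattern P lo hi ↔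
    ∀ W ∈ box E lam L lo hi, P.pos p.1 W = P.pos p.1 hi → P.pos p.2 lo < P.pos p.2 W := by
  simp [pattern]

theorem pattern_mono (hL : IsCutLattice E s t lam L) (hlo : lo ∈ tightSets E lam L)
    (hhi : hi ∈ tightSets E lam L) (hlo' : lo' ∈ box E lam L lo hi)
    (hhi' : hi' ∈ box E lam L lo' hi) : pattern P lo' hi' ⊆ pattern P lo hi := by
  rintro ⟨j, i⟩ h
  rw [mem_pattern] at h ⊢
  intro W hW hj
  have h1 : (W ∩ hi') ∪ lo' ∈ tightSets E lam L :=
    hL.union_mem_tightSets (hL.inter_mem_tightSets hW.1 hhi'.1) hlo'.1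
  have h2 := h _ ⟨h1, Set.subset_union_right,
    Set.union_subset Set.inter_subset_right hhi'.2.1⟩
  simp only [Labelling.pos_union hL (hL.inter_mem_tightSets hW.1 hhi'.1) hlo'.1,
    Labelling.pos_inter hL hW.1 hhi'.1] at h2
  have h3 := Labelling.pos_mono (P := P) hhi'.1 hhi hhi'.2.2 j
  have h4 := Labelling.pos_mono (P := P) hlo'.1 hhi'.1 hhi'.2.1 j
  have h5 := Labelling.pos_mono (P := P) hlo hlo'.1 hlo'.2.1 i
  simp only at hj ⊢
  omega

theorem diag_mem_pattern (hhi : hi ∈ tightSets E lam L) (h : lo ⊆ hi) {i : Fin lam} :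
    (i, i) ∈ pattern P lo hi ↔ P.pos i lo < P.pos i hi := by
  rw [mem_pattern]
  exact ⟨fun h' => h' hi ⟨hhi, h, subset_rfl⟩ rfl, fun h' W _ hW' => hW' ▸ h'⟩

theorem pattern_self (hlo : lo ∈ tightSets E lam L) : pattern P lo lo = ∅ := by
  ext p
  simp only [mem_pattern, Finset.notMem_empty, iff_false]
  exact fun h => lt_irrefl _ (h lo ⟨hlo, subset_rfl, subset_rfl⟩ rfl)

theorem pattern_inter (hL : IsCutLattice E s t lam L) (hY : Y ∈ tightSets E lam L)
    (hZ : Z ∈ tightSets E lam L) {H : Finset (Fin lam × Fin lam)}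
    (h1 : H ⊆ pattern P lo Y) (h2 : H ⊆ pattern P lo Z) : H ⊆ pattern P lo (Y ∩ Z) := by
  intro p hp
  have h1 := mem_pattern.1 (h1 hp)
  have h2 := mem_pattern.1 (h2 hp)
  rw [mem_pattern]
  intro W hW hj
  rw [Labelling.pos_inter hL hY hZ] at hj
  rcases min_cases (P.pos p.1 Y) (P.pos p.1 Z) with h | h
  · exact h1 W (box_mono subset_rfl Set.inter_subset_left hW) (hj.trans h.1)
  · exact h2 W (box_mono subset_rfl Set.inter_subset_right hW) (hj.trans h.1)

theorem Fit.pattern_nonempty (hlo : lo ∈ tightSets E lam L) (hhi : hi ∈ tightSets E lam L)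
    (hX : Fit E s t lam L k lo hi X) : (pattern P lo hi).Nonempty := by
  have hsub := hX.lo_subset.trans hX.subset_hi
  by_contra hne
  rw [Finset.not_nonempty_iff_eq_empty] at hne
  refine hX.not_subset lo ⟨hlo, subset_rfl, hsub⟩ fun e he => ?_
  obtain ⟨i, rfl⟩ := Labelling.exists_ed_eq (P := P) hlo he
  have hi1 : ¬ P.pos i lo < P.pos i hi := by
    rw [← diag_mem_pattern hhi hsub, hne]
    exact Finset.notMem_empty _
  have he' := mem_deltaPlus.1 he
  exact mem_deltaPlus.2 ⟨he'.1, hX.lo_subset he'.2.1, fun h =>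
    hi1 ((Labelling.ed_snd_mem hlo hhi).1 (hX.subset_hi h))⟩

/-- A set of labels closed under the pattern is realised by a tight set in the box. -/
theorem exists_mem_box_of_closed (hL : IsCutLattice E s t lam L) (hlo : lo ∈ tightSets E lam L)
    (hhi : hi ∈ tightSets E lam L) (hsub : lo ⊆ hi) (I : Finset (Fin lam))
    (hI : ∀ j ∈ I, ∀ i ∉ I, (j, i) ∉ pattern P lo hi) :
    ∃ W ∈ box E lam L lo hi, ∀ i, P.pos i W = if i ∈ I then P.pos i hi else P.pos i lo := by
  have hge : ∀ W ∈ box E lam L lo hi, ∀ i, P.pos i lo ≤ P.pos i W := fun W hW i =>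
    Labelling.pos_mono hlo hW.1 hW.2.1 i
  have hle : ∀ W ∈ box E lam L lo hi, ∀ i, P.pos i W ≤ P.pos i hi := fun W hW i =>
    Labelling.pos_mono hW.1 hhi hW.2.2 i
  have h1 : ∀ j, ∀ F : Finset (Fin lam), (∀ i ∈ F, (j, i) ∉ pattern P lo hi) →
      ∃ W ∈ box E lam L lo hi, P.pos j W = P.pos j hi ∧ ∀ i ∈ F, P.pos i W = P.pos i lo := by
    intro j F
    induction F using Finset.induction with
    | empty => exact fun _ => ⟨hi, ⟨hhi, hsub, subset_rfl⟩, rfl, by simp⟩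
    | insert a F _ ih =>
      intro hF
      obtain ⟨W, hW, hj, hWF⟩ := ih fun i hi => hF i (Finset.mem_insert_of_mem hi)
      have ha := hF a (Finset.mem_insert_self _ _)
      rw [mem_pattern] at ha
      push Not at ha
      obtain ⟨W', hW', hj', ha'⟩ := ha
      simp only at hj' ha'
      refine ⟨W ∩ W', inter_mem_box hL hW hW', ?_, fun i hi => ?_⟩
      · rw [Labelling.pos_inter hL hW.1 hW'.1]
        omega
      · have := hge W hW i
        have := hge W' hW' i
        rw [Labelling.pos_inter hL hW.1 hW'.1]
        rcases Finset.mem_insert.1 hi with rfl | hi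
        · omega
        · have := hWF i hi
          omega
  have h2 : ∀ G : Finset (Fin lam), G ⊆ I → ∃ W ∈ box E lam L lo hi,
      (∀ j ∈ G, P.pos j W = P.pos j hi) ∧ ∀ i ∉ I, P.pos i W = P.pos i lo := by
    intro G
    induction G using Finset.induction with
    | empty => exact fun _ => ⟨lo, ⟨hlo, subset_rfl, hsub⟩, by simp, fun _ _ => rfl⟩
    | insert a G _ ih =>
      intro hG
      obtain ⟨W, hW, hWG, hWI⟩ := ih fun i hi => hG (Finset.mem_insert_of_mem hi)
      obtain ⟨W', hW', ha, hWI'⟩ := h1 a Iᶜ fun i hi =>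
        hI a (hG (Finset.mem_insert_self _ _)) i (Finset.mem_compl.1 hi)
      refine ⟨W ∪ W', union_mem_box hL hW hW', fun j hj => ?_, fun i hi => ?_⟩
      · have := hle W hW j
        have := hle W' hW' j
        rw [Labelling.pos_union hL hW.1 hW'.1]
        rcases Finset.mem_insert.1 hj with rfl | hj
        · omega
        · have := hWG j hj
          omega
      · have := hWI i hi
        have := hWI' i (Finset.mem_compl.2 hi)
        rw [Labelling.pos_union hL hW.1 hW'.1]
        omega
  obtain ⟨W, hW, h3, h4⟩ := h2 I subset_rfl
  refine ⟨W, hW, fun i => ?_⟩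
  split_ifs with h
  exacts [h3 i h, h4 i h]

/-! ### Clean blocks -/

/-- A block of the chain on which `X` agrees with a tight set taking only extreme positions. -/
def Clean (P : Labelling E lam (tightSets E lam L)) (X Y Z : Set V) : Prop :=
  (X ∩ Z) ∪ Y ∈ tightSets E lam L ∧
    ∀ i, P.pos i ((X ∩ Z) ∪ Y) = P.pos i Y ∨ P.pos i ((X ∩ Z) ∪ Y) = P.pos i Z

theorem Clean.exists_sandwich (hL : IsCutLattice E s t lam L) (hlo : lo ∈ tightSets E lam L)
    (hhi : hi ∈ tightSets E lam L) (hX : Fit E s t lam L k lo hi X)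
    (hY : Y ∈ box E lam L lo hi) (hZ : Z ∈ box E lam L Y hi)
    (htight : pattern P lo hi ⊆ pattern P Y Z) (hc : Clean P X Y Z) :
    ∃ I : Finset (Fin lam),
      (∃ W ∈ box E lam L lo hi, ∀ i, P.pos i W = if i ∈ I then P.pos i hi else P.pos i lo) ∧
      ∀ W ∈ box E lam L lo hi,
        (∀ i, P.pos i W = if i ∈ I then P.pos i hi else P.pos i lo) →
        (Z ∩ W) ∩ touched E s t (tightSets E lam L) ⊆ X ∧
          X ∩ touched E s t (tightSets E lam L) ⊆ Y ∪ W := by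
  have hsub := hX.lo_subset.trans hX.subset_hi
  have hZ' : Z ∈ box E lam L lo hi := box_mono hY.2.1 subset_rfl hZ
  have hloY := Labelling.pos_mono (P := P) hlo hY.1 hY.2.1
  have hYZ := Labelling.pos_mono (P := P) hY.1 hZ.1 hZ.2.1
  have hZhi := Labelling.pos_mono (P := P) hZ.1 hhi hZ.2.2
  obtain ⟨hA, hpos⟩ := hc
  set A := (X ∩ Z) ∪ Y with hAdef
  have hAbox : A ∈ box E lam L Y Z :=
    ⟨hA, Set.subset_union_right, Set.union_subset Set.inter_subset_right hZ.2.1⟩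
  refine ⟨Finset.univ.filter fun i => P.pos i A ≠ P.pos i Y,
    exists_mem_box_of_closed hL hlo hhi hsub _ fun j hj i hi hji => ?_, fun W hW hWpos => ⟨?_, ?_⟩⟩
  · simp only [Finset.mem_filter, Finset.mem_univ, true_and, not_not] at hj hi
    have := mem_pattern.1 (htight hji) A hAbox ((hpos j).resolve_left hj)
    simp only at this
    omega
  · refine hX.subset_of_fst _ (inter_mem_box hL hZ' hW) fun e he => ?_
    obtain ⟨i, rfl⟩ := Labelling.exists_ed_eq (P := P) (inter_mem_box hL hZ' hW).1 he
    have hp := Labelling.pos_inter (P := P) hL hZ'.1 hW.1 i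
    have h1 := hWpos i
    have := hloY i
    have := hYZ i
    have := hZhi i
    by_cases hi : P.pos i A = P.pos i Y
    · rw [if_neg (by simpa using hi)] at h1
      have h2 : P.pos i (Z ∩ W) = P.pos i lo := by omega
      rw [Labelling.ed_congr h2]
      exact hX.lo_subset ((Labelling.ed_fst_mem hlo hlo).2 le_rfl)
    · rw [if_pos (by simpa using hi)] at h1
      have h3 := (hpos i).resolve_left hi
      have h2 : P.pos i (Z ∩ W) = P.pos i A := by omega
      rw [Labelling.ed_congr h2]
      rcases (Labelling.ed_fst_mem (P := P) (i := i) hA hA).2 le_rfl with h | h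
      · exact h.1
      · have := (Labelling.ed_fst_mem hA hY.1).1 h
        omega
  · have hU := union_mem_box hL hY hW
    refine hX.subset_of_snd _ hU fun e he heX => ?_
    obtain ⟨i, rfl⟩ := Labelling.exists_ed_eq (P := P) hU.1 he
    have hp := Labelling.pos_union (P := P) hL hY.1 hW.1 i
    have h1 := hWpos i
    have := hloY i
    have := hYZ i
    have := hZhi i
    by_cases hi : P.pos i A = P.pos i Y
    · rw [if_neg (by simpa using hi)] at h1
      have h2 : P.pos i (Y ∪ W) = P.pos i A := by omega
      have h3 := (Labelling.ed_snd_mem hU.1 hhi).1 (hX.subset_hi heX)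
      have h4 : (P.ed i (Y ∪ W)).2 ∉ Z := fun h => by
        have h5 : (P.ed i A).2 ∈ A := by
          rw [← Labelling.ed_congr h2]
          exact Or.inl ⟨heX, h⟩
        exact lt_irrefl _ ((Labelling.ed_snd_mem hA hA).1 h5)
      rw [Labelling.ed_snd_mem hU.1 hZ.1] at h4
      have h5 := (diag_mem_pattern (P := P) hhi hsub (i := i)).2 (by omega)
      have h6 := (diag_mem_pattern hZ.1 hZ.2.1).1 (htight h5)
      omega
    · rw [if_pos (by simpa using hi)] at h1
      have h3 := (Labelling.ed_snd_mem hU.1 hhi).1 (hX.subset_hi heX)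
      omega

/-- A fitting set is clean on all but at most `2 * k` blocks of a chain. -/
theorem Fit.exists_clean (hL : IsCutLattice E s t lam L) (hX : Fit E s t lam L k lo hi X)
    {c : ℕ → Set V} (hmono : Monotone c) (hc : ∀ a, c a ∈ box E lam L lo hi)
    (b : ℕ) : ∃ a, b ≤ a ∧ a < b + (2 * k + 1) ∧ Clean P X (c a) (c (a + 1)) := by
  by_contra! hno
  set A : ℕ → Set V := fun a => (X ∩ c (a + 1)) ∪ c a with hA
  have hAL : ∀ a, A a ∈ L := fun a =>
    hL.union_mem _ (hL.inter_mem _ hX.mem _ (hc _).1.1) _ (hc a).1.1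
  set N := b + (2 * k + 1) with hN
  have hsum : ∀ m, ∑ a ∈ Finset.range m, (deltaPlus E (A a)).card + lam ≤
      (deltaPlus E (X ∩ c m)).card + m * lam := by
    intro m
    induction m with
    | zero => simpa using hL.le_card _ (hL.inter_mem _ hX.mem _ (hc 0).1.1)
    | succ m ih =>
      have h1 := card_deltaPlus_submodular E (X ∩ c (m + 1)) (c m)
      have h2 : X ∩ c (m + 1) ∩ c m = X ∩ c m := by
        rw [Set.inter_assoc, Set.inter_eq_self_of_subset_right (hmono (Nat.le_succ m))]
      rw [h2, (hc m).1.2] at h1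
      rw [Finset.sum_range_succ, Nat.succ_mul]
      simp only [hA] at ih ⊢
      omega
  set D₁ := (Finset.range N).filter fun a => A a ∉ tightSets E lam L with hD₁
  set D₂ := (Finset.range N).filter fun a => A a ∈ tightSets E lam L ∧
    ¬ Clean P X (c a) (c (a + 1)) with hD₂
  have hcard₁ : D₁.card ≤ k := by
    have h1 : N * lam + D₁.card ≤ ∑ a ∈ Finset.range N, (deltaPlus E (A a)).card := by
      calc N * lam + D₁.card =
          ∑ a ∈ Finset.range N, (lam + if A a ∉ tightSets E lam L then 1 else 0) := by
            rw [Finset.sum_add_distrib, hD₁, Finset.card_filter]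
            simp
        _ ≤ _ := by
            refine Finset.sum_le_sum fun a _ => ?_
            have h2 := hL.le_card _ (hAL a)
            by_cases h : A a ∈ tightSets E lam L
            · simpa [h] using h2
            · have : (deltaPlus E (A a)).card ≠ lam := fun h' => h ⟨hAL a, h'⟩
              simp only [h, not_false_eq_true, if_true]
              omega
    have h2 := hsum N
    have h3 := hL.card_inter_le hX.mem (hc N).1
    have h4 := hX.card_le
    omega
  have hcard₂ : D₂.card ≤ k := by
    have hex : ∀ a ∈ D₂, ∃ e ∈ deltaPlus E X, e.2 ∈ c (a + 1) ∧ e.2 ∉ c a := by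
      intro a ha
      obtain ⟨-, hAt, hcl⟩ := Finset.mem_filter.1 ha
      have : ∃ i, P.pos i (A a) ≠ P.pos i (c a) ∧ P.pos i (A a) ≠ P.pos i (c (a + 1)) := by
        by_contra! h
        exact hcl ⟨hAt, fun i => or_iff_not_imp_left.2 (h i)⟩
      obtain ⟨i, h1, h2⟩ := this
      have h3 := Labelling.pos_mono (P := P) (hc a).1 hAt Set.subset_union_right i
      have h4 := Labelling.pos_mono (P := P) hAt (hc (a + 1)).1
        (Set.union_subset Set.inter_subset_right (hmono (Nat.le_succ a))) i
      have h5 : (P.ed i (A a)).1 ∉ c a := fun h => by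
        have := (Labelling.ed_fst_mem hAt (hc a).1).1 h
        omega
      have h6 : (P.ed i (A a)).2 ∈ c (a + 1) :=
        (Labelling.ed_snd_mem hAt (hc (a + 1)).1).2 (by omega)
      obtain ⟨h7, h8, h9⟩ := mem_deltaPlus.1 (Labelling.ed_mem (P := P) hAt i)
      exact ⟨P.ed i (A a), mem_deltaPlus.2 ⟨h7, (h8.resolve_right h5).1,
        fun h => h9 (Or.inl ⟨h, h6⟩)⟩, h6, fun h => h9 (Or.inr h)⟩
    have : Nonempty (V × V) := ⟨(s, s)⟩
    choose! e he1 he2 he3 using hex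
    refine (Finset.card_le_card_of_injOn e he1 ?_).trans hX.card_le
    intro a ha a' ha' haa'
    by_contra hne
    rcases Nat.lt_or_gt_of_ne hne with h | h
    · exact he3 a' ha' (haa' ▸ hmono h (he2 a ha))
    · exact he3 a ha (haa' ▸ hmono h (he2 a' ha'))
  have hsub : Finset.Ico b N ⊆ D₁ ∪ D₂ := by
    intro a ha
    rw [Finset.mem_Ico] at ha
    rw [Finset.mem_union, Finset.mem_filter, Finset.mem_filter, Finset.mem_range]
    by_cases h : A a ∈ tightSets E lam L
    · exact Or.inr ⟨ha.2, h, hno a ha.1 ha.2⟩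
    · exact Or.inl ⟨ha.2, h⟩
  have h1 := (Finset.card_le_card hsub).trans (Finset.card_union_le _ _)
  rw [Nat.card_Ico] at h1
  omega

end Box

section Round

variable {E : Finset (V × V)} {s t : V} {lam k : ℕ} {L : Set (Set V)}
  {P : Labelling E lam (tightSets E lam L)} {lo hi lo' hi' X Y Z W : Set V}

/-! ### Restricting a fitting set -/

theorem Fit.of_inter_eq {X' : Set V} (hX : Fit E s t lam L k lo hi X) (hlo : lo ⊆ lo')
    (hhi : hi' ⊆ hi) (hX' : X' ∈ L) (hlo' : lo' ⊆ X') (hhi' : X' ⊆ hi')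
    (hk : (deltaPlus E X').card ≤ k)
    (h : X' ∩ touched E s t (tightSets E lam L) = X ∩ touched E s t (tightSets E lam L)) :
    Fit E s t lam L k lo' hi' X' := by
  have key : ∀ v ∈ touched E s t (tightSets E lam L), v ∈ X' ↔ v ∈ X := fun v hv => by
    have := Set.ext_iff.1 h v
    simpa [hv] using this
  have h1 : ∀ Y ∈ tightSets E lam L, ∀ e ∈ deltaPlus E Y, (e.1 ∈ X' ↔ e.1 ∈ X) :=
    fun Y hY e he => key _ (Or.inr (Or.inr ⟨Y, hY, e, he, Or.inl rfl⟩))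
  have h2 : ∀ Y ∈ tightSets E lam L, ∀ e ∈ deltaPlus E Y, (e.2 ∈ X' ↔ e.2 ∈ X) :=
    fun Y hY e he => key _ (Or.inr (Or.inr ⟨Y, hY, e, he, Or.inr rfl⟩))
  refine ⟨hX', hlo', hhi', hk, fun Y hY hsub => ?_, fun Y hY hsnd => ?_, fun Y hY hfst => ?_⟩
  · refine hX.not_subset Y (box_mono hlo hhi hY) fun e he => ?_
    have := mem_deltaPlus.1 (hsub he)
    rwa [h1 Y hY.1 e he, h2 Y hY.1 e he, ← mem_deltaPlus] at this
  · rw [h]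
    exact hX.subset_of_snd Y (box_mono hlo hhi hY) fun e he => (h2 Y hY.1 e he).not.1 (hsnd e he)
  · intro v hv
    exact (key v hv.2).2 (hX.subset_of_fst Y (box_mono hlo hhi hY)
      (fun e he => (h1 Y hY.1 e he).1 (hfst e he)) hv)

/-- `X` agrees with `W` outside the tight set `Z` and contains `W` inside `Z`. -/
def Sandwich (B X Z W : Set V) : Prop := (Z ∩ W) ∩ B ⊆ X ∧ X ∩ B ⊆ Z ∪ W

theorem Fit.inter_of_sandwich (hL : IsCutLattice E s t lam L)
    (P : Labelling E lam (tightSets E lam L)) (hX : Fit E s t lam L k lo hi X)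
    (hZ : Z ∈ box E lam L lo hi) (hW : W ∈ box E lam L lo hi)
    (hsw : Sandwich (touched E s t (tightSets E lam L)) X Z W)
    (hN : ∀ Y ∈ box E lam L lo W, ¬ deltaPlus E Y ⊆ deltaPlus E (X ∩ W)) :
    Fit E s t lam L k lo W (X ∩ W) := by
  refine ⟨hL.inter_mem _ hX.mem _ hW.1.1, Set.subset_inter hX.lo_subset hW.2.1,
    Set.inter_subset_right, (hL.card_inter_le hX.mem hW.1).trans hX.card_le, hN,
    fun Y hY hsnd => ?_, fun Y hY hfst => ?_⟩
  · have hYb := box_mono (subset_refl lo) hW.2.2 hY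
    have hpos : ∀ i, min (P.pos i Z) (P.pos i W) ≤ P.pos i Y := fun i => by
      by_contra! h
      rw [lt_min_iff] at h
      have h1 := (Labelling.ed_snd_mem hY.1 hZ.1).2 h.1
      have h2 := (Labelling.ed_snd_mem hY.1 hW.1).2 h.2
      exact hsnd _ (Labelling.ed_mem hY.1 i)
        ⟨hsw.1 ⟨⟨h1, h2⟩, Labelling.ed_snd_mem_touched hY.1 i⟩, h2⟩
    have hU := union_mem_box hL hYb hZ
    have h3 := hX.subset_of_snd _ hU fun e he heX => by
      obtain ⟨i, rfl⟩ := Labelling.exists_ed_eq (P := P) hU.1 he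
      have hp := Labelling.pos_union (P := P) hL hY.1 hZ.1 i
      have h4 := hsw.2 ⟨heX, Labelling.ed_snd_mem_touched hU.1 i⟩
      have h6 := hpos i
      rcases le_or_gt (P.pos i Z) (P.pos i Y) with h | h
      · have h5 : P.pos i (Y ∪ Z) = P.pos i Y := by omega
        rw [Labelling.ed_congr h5] at heX h4
        refine hsnd _ (Labelling.ed_mem hY.1 i) ⟨heX, h4.resolve_left fun h' => ?_⟩
        have := (Labelling.ed_snd_mem hY.1 hZ.1).1 h'
        omega
      · rcases h4 with h4 | h4
        · have := (Labelling.ed_snd_mem hU.1 hZ.1).1 h4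
          omega
        · have := (Labelling.ed_snd_mem hU.1 hW.1).1 h4
          omega
    rintro v ⟨⟨hvX, hvW⟩, hvB⟩
    refine (h3 ⟨hvX, hvB⟩).elim id fun hvZ => ?_
    refine Labelling.inter_touched_subset (P := P) hL (inter_mem_box hL hZ hW).1 hY.1
      (fun i => ?_) ⟨⟨hvZ, hvW⟩, hvB⟩
    rw [Labelling.pos_inter hL hZ.1 hW.1]
    exact hpos i
  · exact fun v hv => ⟨hX.subset_of_fst Y (box_mono subset_rfl hW.2.2 hY)
      (fun e he => (hfst e he).1) hv, hY.2.2 hv.1⟩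

theorem Fit.union_of_sandwich (hL : IsCutLattice E s t lam L)
    (P : Labelling E lam (tightSets E lam L)) (hX : Fit E s t lam L k lo hi X)
    (hZ : Z ∈ box E lam L lo hi) (hW : W ∈ box E lam L lo hi)
    (hsw : Sandwich (touched E s t (tightSets E lam L)) X Z W)
    (hN : ∀ Y ∈ box E lam L W hi, ¬ deltaPlus E Y ⊆ deltaPlus E (X ∪ W)) :
    Fit E s t lam L k W hi (X ∪ W) := by
  refine ⟨hL.union_mem _ hX.mem _ hW.1.1, Set.subset_union_right,
    Set.union_subset hX.subset_hi hW.2.2, (hL.card_union_le hX.mem hW.1).trans hX.card_le, hN,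
    fun Y hY hsnd => ?_, fun Y hY hfst => ?_⟩
  · rintro v ⟨hv | hv, hvB⟩
    · exact hX.subset_of_snd Y (box_mono hW.2.1 subset_rfl hY)
        (fun e he h => hsnd e he (Or.inl h)) ⟨hv, hvB⟩
    · exact hY.2.1 hv
  · have hYb := box_mono hW.2.1 (subset_refl hi) hY
    have hpos : ∀ i, P.pos i Y ≤ max (P.pos i Z) (P.pos i W) := fun i => by
      by_contra! h
      rw [max_lt_iff] at h
      have h1 : (P.ed i Y).1 ∉ Z := fun h' => by
        have := (Labelling.ed_fst_mem hY.1 hZ.1).1 h'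
        omega
      have h2 : (P.ed i Y).1 ∉ W := fun h' => by
        have := (Labelling.ed_fst_mem hY.1 hW.1).1 h'
        omega
      have h3 := (hfst _ (Labelling.ed_mem hY.1 i)).resolve_right h2
      exact (hsw.2 ⟨h3, Labelling.ed_fst_mem_touched hY.1 i⟩).elim h1 h2
    have hI := inter_mem_box hL hYb hZ
    have h3 := hX.subset_of_fst _ hI fun e he => by
      obtain ⟨i, rfl⟩ := Labelling.exists_ed_eq (P := P) hI.1 he
      have hp := Labelling.pos_inter (P := P) hL hY.1 hZ.1 i
      have h6 := hpos i
      have h7 : (P.ed i (Y ∩ Z)).1 ∈ Z := (Labelling.ed_fst_mem hI.1 hZ.1).2 (by omega)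
      have h8 : (P.ed i (Y ∩ Z)).1 ∈ X ∪ W := by
        rcases le_total (P.pos i Y) (P.pos i Z) with h | h
        · have h5 : P.pos i (Y ∩ Z) = P.pos i Y := by omega
          rw [Labelling.ed_congr h5]
          exact hfst _ (Labelling.ed_mem hY.1 i)
        · rcases h.eq_or_lt with h | h
          · have h5 : P.pos i (Y ∩ Z) = P.pos i Y := by omega
            rw [Labelling.ed_congr h5]
            exact hfst _ (Labelling.ed_mem hY.1 i)
          · exact Or.inr ((Labelling.ed_fst_mem hI.1 hW.1).2 (by omega))
      exact h8.elim id fun h => hsw.1 ⟨⟨h7, h⟩, Labelling.ed_fst_mem_touched hI.1 i⟩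
    rintro v ⟨hvY, hvB⟩
    by_cases hvW : v ∈ W
    · exact Or.inr hvW
    · have hvZ := Labelling.inter_touched_subset (P := P) hL hY.1 (union_mem_box hL hZ hW).1
        (fun i => by rw [Labelling.pos_union hL hZ.1 hW.1]; exact hpos i) ⟨hvY, hvB⟩
      exact Or.inl (h3 ⟨⟨hvY, hvZ.resolve_right hvW⟩, hvB⟩)

theorem Fit.inter_or_union (hL : IsCutLattice E s t lam L)
    (P : Labelling E lam (tightSets E lam L)) (hlo : lo ∈ tightSets E lam L)
    (hhi : hi ∈ tightSets E lam L)
    (hX : Fit E s t lam L k lo hi X)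
    (hZ : Z ∈ box E lam L lo hi) (hW : W ∈ box E lam L lo hi)
    (hmix : ∀ i, P.pos i W = P.pos i hi ∨ P.pos i W = P.pos i lo)
    (hsw : Sandwich (touched E s t (tightSets E lam L)) X Z W) :
    Fit E s t lam L k lo W (X ∩ W) ∨ Fit E s t lam L k W hi (X ∪ W) := by
  by_contra! hno
  have h1 : ¬ ∀ Y ∈ box E lam L lo W, ¬ deltaPlus E Y ⊆ deltaPlus E (X ∩ W) :=
    fun hN => hno.1 (hX.inter_of_sandwich hL P hZ hW hsw hN)
  have h2 : ¬ ∀ Y ∈ box E lam L W hi, ¬ deltaPlus E Y ⊆ deltaPlus E (X ∪ W) :=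
    fun hN => hno.2 (hX.union_of_sandwich hL P hZ hW hsw hN)
  push Not at h1 h2
  obtain ⟨U, hU, hUX⟩ := h1
  obtain ⟨U', hU', hUX'⟩ := h2
  have hUb := box_mono (subset_refl lo) hW.2.2 hU
  have hUb' := box_mono hW.2.1 (subset_refl hi) hU'
  have hI := inter_mem_box hL hUb' hZ
  have hY := union_mem_box hL hUb hI
  refine hX.not_subset _ hY fun e he => ?_
  obtain ⟨i, rfl⟩ := Labelling.exists_ed_eq (P := P) hY.1 he
  have hp := Labelling.pos_union (P := P) hL hU.1 hI.1 i
  rw [Labelling.pos_inter hL hU'.1 hZ.1] at hp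
  have hloU := Labelling.pos_mono (P := P) hlo hU.1 hU.2.1 i
  have hUW := Labelling.pos_mono (P := P) hU.1 hW.1 hU.2.2 i
  have hWU' := Labelling.pos_mono (P := P) hW.1 hU'.1 hU'.2.1 i
  have hU'hi := Labelling.pos_mono (P := P) hU'.1 hhi hU'.2.2 i
  have hloZ := Labelling.pos_mono (P := P) hlo hZ.1 hZ.2.1 i
  have hZhi := Labelling.pos_mono (P := P) hZ.1 hhi hZ.2.2 i
  have heU := hUX (Labelling.ed_mem (P := P) hU.1 i)
  have heU' := hUX' (Labelling.ed_mem (P := P) hU'.1 i)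
  rw [mem_deltaPlus] at heU heU'
  by_cases hi1 : P.pos i W = P.pos i hi
  · have hge : P.pos i Z ≤ P.pos i U := by
      by_contra! h
      have h3 := (Labelling.ed_snd_mem hU.1 hZ.1).2 h
      have h4 := (Labelling.ed_snd_mem (P := P) (i := i) hU.1 hW.1).2 (by omega)
      exact heU.2.2 ⟨hsw.1 ⟨⟨h3, h4⟩, Labelling.ed_snd_mem_touched hU.1 i⟩, h4⟩
    have h3 : P.pos i (U ∪ U' ∩ Z) = P.pos i U := by omega
    rw [Labelling.ed_congr h3, mem_deltaPlus]
    refine ⟨heU.1, heU.2.1.1, fun h => ?_⟩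
    have h4 := (Labelling.ed_snd_mem hU.1 hhi).1 (hX.subset_hi h)
    exact heU.2.2 ⟨h, (Labelling.ed_snd_mem hU.1 hW.1).2 (by omega)⟩
  · have hi2 := (hmix i).resolve_left hi1
    have hle : P.pos i U' ≤ P.pos i Z := by
      by_contra! h
      have h3 : (P.ed i U').1 ∉ Z := fun h' => by
        have := (Labelling.ed_fst_mem hU'.1 hZ.1).1 h'
        omega
      have h4 : (P.ed i U').1 ∉ W := fun h' => by
        have := (Labelling.ed_fst_mem hU'.1 hW.1).1 h'
        omega
      exact (hsw.2 ⟨heU'.2.1.resolve_right h4, Labelling.ed_fst_mem_touched hU'.1 i⟩).elim h3 h4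
    have h3 : P.pos i (U ∪ U' ∩ Z) = P.pos i U' := by omega
    rw [Labelling.ed_congr h3, mem_deltaPlus]
    refine ⟨heU'.1, heU'.2.1.elim id fun h => ?_, fun h => heU'.2.2 (Or.inl h)⟩
    have h4 := (Labelling.ed_fst_mem hU'.1 hW.1).1 h
    exact hX.lo_subset ((Labelling.ed_fst_mem hU'.1 hlo).2 (by omega))

/-! ### The chain of tight blocks -/

theorem exists_block [Finite V] (hL : IsCutLattice E s t lam L) (hhi : hi ∈ tightSets E lam L)
    (H : Finset (Fin lam × Fin lam)) (hYhi : Y ⊆ hi) :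
    ∃ Z ∈ box E lam L Y hi, (H ⊆ pattern P Y Z ∨ Z = hi) ∧
      ∀ W ∈ box E lam L Y hi, H ⊆ pattern P Y W → Z ⊆ W := by
  by_cases h : {Z | Z ∈ box E lam L Y hi ∧ H ⊆ pattern P Y Z}.Nonempty
  · obtain ⟨Z, hZ, hmin⟩ :=
      ({Z | Z ∈ box E lam L Y hi ∧ H ⊆ pattern P Y Z}).toFinite.exists_minimal h
    refine ⟨Z, hZ.1, Or.inl hZ.2, fun W hW hWH => ?_⟩
    exact (hmin ⟨inter_mem_box hL hZ.1 hW, pattern_inter hL hZ.1.1 hW.1 hZ.2 hWH⟩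
      Set.inter_subset_left).trans Set.inter_subset_right
  · exact ⟨hi, ⟨hhi, hYhi, subset_rfl⟩, Or.inr rfl, fun W hW hWH => absurd ⟨W, hW, hWH⟩ h⟩

theorem exists_blocks [Finite V] (hL : IsCutLattice E s t lam L) (hlo : lo ∈ tightSets E lam L)
    (hhi : hi ∈ tightSets E lam L) (hsub : lo ⊆ hi) (hne : (pattern P lo hi).Nonempty) :
    ∃ c : ℕ → Set V, c 0 = lo ∧ Monotone c ∧ (∀ a, c a ∈ box E lam L lo hi) ∧
      (∃ N, c N = hi) ∧ (∀ a, pattern P lo hi ⊆ pattern P (c a) (c (a + 1)) ∨ c (a + 1) = hi) ∧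
      ∀ a, ∀ W ∈ box E lam L (c a) hi, pattern P lo hi ⊆ pattern P (c a) W → c (a + 1) ⊆ W := by
  have hstep : ∀ Y : box E lam L lo hi, ∃ Z : box E lam L lo hi, (Y : Set V) ⊆ Z ∧
      (pattern P lo hi ⊆ pattern P Y Z ∨ (Z : Set V) = hi) ∧
      ∀ W ∈ box E lam L Y hi, pattern P lo hi ⊆ pattern P Y W → (Z : Set V) ⊆ W := by
    rintro ⟨Y, hY⟩
    obtain ⟨Z, hZ, h⟩ := exists_block (P := P) hL hhi (pattern P lo hi) hY.2.2
    exact ⟨⟨Z, box_mono hY.2.1 subset_rfl hZ⟩, hZ.2.1, h⟩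
  choose next h1 h2 h3 using hstep
  set c : ℕ → box E lam L lo hi := fun a => next^[a] ⟨lo, hlo, subset_rfl, hsub⟩ with hc
  have hsucc : ∀ a, c (a + 1) = next (c a) := fun a => Function.iterate_succ_apply' _ _ _
  have hmono : Monotone fun a => (c a : Set V) :=
    monotone_nat_of_le_succ fun a => by rw [hsucc]; exact h1 _
  refine ⟨fun a => c a, rfl, hmono, fun a => (c a).2, ?_, fun a => ?_, fun a => ?_⟩
  · obtain ⟨n, hn⟩ := WellFoundedGT.monotone_chain_condition ⟨fun a => (c a : Set V), hmono⟩
    have h4 : (c n : Set V) = c (n + 1) := hn (n + 1) (Nat.le_succ n)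
    refine ⟨n + 1, ?_⟩
    have h5 := h2 (c n)
    rw [← hsucc] at h5
    refine h5.resolve_left fun h6 => ?_
    rw [← h4, pattern_self (c n).2.1] at h6
    exact hne.ne_empty (Finset.subset_empty.1 h6)
  · simp only [hsucc]
    exact h2 _
  · simp only [hsucc]
    exact h3 _

end Round

/-! ### Avoiding the tight sets of a box -/

section Killable

variable {E : Finset (V × V)} {s t : V} {lam k : ℕ} {L : Set (Set V)}
  {P : Labelling E lam (tightSets E lam L)} {lo hi Y Z : Set V} {ι : Type*} {w : ι → ℝ}

/-- Every weighted family of sets fitting in the box from `lo` to `hi` has a subfamily carrying a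
fraction `1 / K` of the weight that does not generate any tight set. -/
def Killable (E : Finset (V × V)) (s t : V) (lam : ℕ) (L : Set (Set V)) (k : ℕ) (w : ι → ℝ)
    (K : ℝ) (lo hi : Set V) : Prop :=
  ∀ (X : ι → Set V) (S : Finset ι), (∀ x ∈ S, Fit E s t lam L k lo hi (X x)) →
    ∃ S' ⊆ S, Kills (touched E s t (tightSets E lam L)) (tightSets E lam L) X S' ∧
      ∑ x ∈ S, w x ≤ K * ∑ x ∈ S', w x

theorem kills_empty (hL : IsCutLattice E s t lam L) (X : ι → Set V) :
    Kills (touched E s t (tightSets E lam L)) (tightSets E lam L) X ∅ := fun T hT hg => by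
  simpa using hg s (hL.source_mem _ hT.1) source_mem_touched t sink_mem_touched
    (hL.sink_notMem _ hT.1)

theorem IsGenerated.exists_sink_notMem {B : Set V} {X : ι → Set V} {S : Finset ι} {T : Set V}
    (h : IsGenerated B X S T) (ht : t ∉ T) (htB : t ∈ B) {u : V} (hu : u ∈ T) (huB : u ∈ B) :
    ∃ x ∈ S, u ∈ X x :=
  let ⟨x, hx, h1, _⟩ := h u hu huB t htB ht
  ⟨x, hx, h1⟩

/-- If no set of the family contains the tail of the `i`-th arc of `Z`, a tight set generated by
the family stays strictly below `Z` on the `i`-th sequence. -/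
theorem IsGenerated.pos_lt (hL : IsCutLattice E s t lam L) {X : ι → Set V} {S : Finset ι}
    {T : Set V} (h : IsGenerated (touched E s t (tightSets E lam L)) X S T)
    (hT : T ∈ tightSets E lam L) (hZ : Z ∈ tightSets E lam L) {i : Fin lam}
    (hX : ∀ x ∈ S, (P.ed i Z).1 ∉ X x) : P.pos i T < P.pos i Z := by
  by_contra! hle
  obtain ⟨x, hx, h1, -⟩ := h _ ((Labelling.ed_fst_mem hZ hT).2 hle)
    (Labelling.ed_fst_mem_touched hZ i) t sink_mem_touched (hL.sink_notMem _ hT.1)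
  exact hX x hx h1

/-- If every set of the family contains the head of the `i`-th arc of `Z`, a tight set generated
by the family lies strictly above `Z` on the `i`-th sequence. -/
theorem IsGenerated.lt_pos (hL : IsCutLattice E s t lam L) {X : ι → Set V} {S : Finset ι}
    {T : Set V} (h : IsGenerated (touched E s t (tightSets E lam L)) X S T)
    (hT : T ∈ tightSets E lam L) (hZ : Z ∈ tightSets E lam L) {i : Fin lam}
    (hX : ∀ x ∈ S, (P.ed i Z).2 ∈ X x) : P.pos i Z < P.pos i T := by
  by_contra hle
  obtain ⟨x, hx, -, h1⟩ := h s (hL.source_mem _ hT.1) source_mem_touched _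
    (Labelling.ed_snd_mem_touched hZ i) ((Labelling.ed_snd_mem hZ hT).not.2 hle)
  exact h1 (hX x hx)

theorem exists_kills_layer [Finite V] (hL : IsCutLattice E s t lam L) (hw : ∀ x, 0 ≤ w x)
    (hlo : lo ∈ tightSets E lam L) (hhi : hi ∈ tightSets E lam L)
    (hY : Y ∈ box E lam L lo hi) (hZ : Z ∈ box E lam L Y hi)
    (hmin : ∀ W ∈ box E lam L Y hi, pattern P lo hi ⊆ pattern P Y W → Z ⊆ W)
    {K : ℝ} (hK : 1 ≤ K)
    (ih : ∀ lo' ∈ box E lam L lo hi, ∀ hi' ∈ box E lam L lo' hi,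
      pattern P lo' hi' ⊂ pattern P lo hi → Killable E s t lam L k w K lo' hi')
    {X : ι → Set V} {S : Finset ι} (hX : ∀ x ∈ S, Fit E s t lam L k lo hi (X x))
    (hYX : ∀ x ∈ S, Y ∩ touched E s t (tightSets E lam L) ⊆ X x) {i : Fin lam}
    (hiX : ∀ x ∈ S, (P.ed i Z).1 ∉ X x) :
    ∃ S' ⊆ S, Kills (touched E s t (tightSets E lam L)) (tightSets E lam L) X S' ∧
      ∑ x ∈ S, w x ≤ ((lam + 1 : ℕ) : ℝ) * K * ∑ x ∈ S', w x := by
  rcases S.eq_empty_or_nonempty with rfl | ⟨x₀, hx₀⟩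
  · exact ⟨∅, subset_rfl, kills_empty hL X, by simp⟩
  have hlt : P.pos i Y < P.pos i Z := by
    have h1 := Labelling.pos_mono (P := P) hY.1 hZ.1 hZ.2.1 i
    refine lt_of_not_ge fun h2 => hiX x₀ hx₀ (hYX x₀ hx₀ ?_)
    exact ⟨(Labelling.ed_fst_mem hZ.1 hY.1).2 h2, Labelling.ed_fst_mem_touched hZ.1 i⟩
  obtain ⟨Q, ⟨hQ, hQi⟩, hQmax⟩ :=
    ({W | W ∈ box E lam L lo hi ∧ P.pos i W < P.pos i Z}).toFinite.exists_maximal ⟨Y, hY, hlt⟩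
  have hQtop : ∀ W ∈ box E lam L lo hi, P.pos i W < P.pos i Z → W ⊆ Q := fun W hW hWi =>
    Set.subset_union_right.trans (hQmax ⟨union_mem_box hL hQ hW, by
      rw [Labelling.pos_union hL hQ.1 hW.1]
      exact max_lt hQi hWi⟩ Set.subset_union_left)
  have hYQ := hQtop Y hY hlt
  have hcases : ∀ x ∈ S, ∃ o : Option (Fin lam), o.elim
      (X x ∩ touched E s t (tightSets E lam L) ⊆ Q) fun j => (P.ed j Q).2 ∈ X x := by
    intro x hx
    by_cases h : ∃ j, (P.ed j Q).2 ∈ X x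
    · obtain ⟨j, hj⟩ := h
      exact ⟨some j, hj⟩
    · push Not at h
      refine ⟨none, (hX x hx).subset_of_snd Q hQ fun e he => ?_⟩
      obtain ⟨j, rfl⟩ := Labelling.exists_ed_eq (P := P) hQ.1 he
      exact h j
  obtain ⟨o, S₁, hS₁, ho, hwS⟩ := exists_heavy_class hw S _ hcases
  have hw0 : ∀ S' : Finset ι, 0 ≤ ∑ x ∈ S', w x := fun S' => Finset.sum_nonneg fun x _ => hw x
  have hcard : Fintype.card (Option (Fin lam)) = lam + 1 := by simp
  rw [hcard] at hwS
  cases o with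
  | some j =>
    refine ⟨S₁, hS₁, fun T hT hg => ?_, ?_⟩
    · have h1 := hg.pos_lt hL hT hZ.1 fun x hx => hiX x (hS₁ hx)
      have h2 := hg.lt_pos hL hT hQ.1 fun x hx => ho x hx
      obtain ⟨x, hx, -⟩ := hg.exists_sink_notMem (hL.sink_notMem _ hT.1) sink_mem_touched
        (hL.source_mem _ hT.1) source_mem_touched
      have h3 := (Labelling.ed_snd_mem hQ.1 hhi).1 ((hX x (hS₁ hx)).subset_hi (ho x hx))
      have hT' := hL.union_mem_tightSets hT hlo
      have hT'' := hL.inter_mem_tightSets hT' hhi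
      have hlohi := hY.2.1.trans hY.2.2
      have h4 := hQtop ((T ∪ lo) ∩ hi) ⟨hT'', Set.subset_inter Set.subset_union_right hlohi,
        Set.inter_subset_right⟩ (by
          have := Labelling.pos_mono (P := P) hlo hY.1 hY.2.1 i
          rw [Labelling.pos_inter hL hT' hhi, Labelling.pos_union hL hT hlo]
          omega)
      have h5 := Labelling.pos_mono (P := P) hT'' hQ.1 h4 j
      rw [Labelling.pos_inter hL hT' hhi, Labelling.pos_union hL hT hlo] at h5
      omega
    · refine hwS.trans (mul_le_mul_of_nonneg_right ?_ (hw0 _))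
      exact le_mul_of_one_le_right (Nat.cast_nonneg _) hK
  | none =>
    have hQY : Q ∈ box E lam L Y hi := ⟨hQ.1, hYQ, hQ.2.2⟩
    have hss : pattern P Y Q ⊂ pattern P lo hi := by
      refine (pattern_mono hL hlo hhi hY hQY).ssubset_of_ne fun h => ?_
      have h1 := Labelling.pos_mono (P := P) hZ.1 hQ.1 (hmin Q hQY h.symm.subset) i
      omega
    obtain ⟨S', hS', hkill, hwS'⟩ := ih Y hY Q hQY hss (fun x => (X x ∪ Y) ∩ Q) S₁ fun x hx => by
      have hx' := hX x (hS₁ hx)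
      have hU := hL.union_mem _ hx'.mem _ hY.1.1
      refine hx'.of_inter_eq hY.2.1 hQ.2.2 (hL.inter_mem _ hU _ hQ.1.1)
        (Set.subset_inter Set.subset_union_right hYQ) Set.inter_subset_right
        ((hL.card_inter_le hU hQ.1).trans ((hL.card_union_le hx'.mem hY.1).trans hx'.card_le)) ?_
      ext v
      constructor
      · rintro ⟨⟨h | h, -⟩, hvB⟩
        exacts [⟨h, hvB⟩, ⟨hYX x (hS₁ hx) ⟨h, hvB⟩, hvB⟩]
      · exact fun h => ⟨⟨Or.inl h.1, ho x hx h⟩, h.2⟩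
    refine ⟨S', hS'.trans hS₁, hkill.of_clip hL hY.1 hQ.1 source_mem_touched sink_mem_touched, ?_⟩
    rw [mul_assoc]
    exact hwS.trans (mul_le_mul_of_nonneg_left hwS' (Nat.cast_nonneg _))

/-- The number of classes distinguished in one round. -/
def roundFactor (lam k : ℕ) : ℕ := (2 ^ lam * 2 + (2 * k + 1) * lam) * (lam + 1)

theorem one_le_roundFactor (lam k : ℕ) : 1 ≤ roundFactor lam k := by
  have h : 1 ≤ 2 ^ lam := Nat.one_le_two_pow
  unfold roundFactor
  nlinarith [Nat.zero_le ((2 * k + 1) * lam), Nat.zero_le (((2 * k + 1) * lam) * lam)]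

theorem killable_of_pattern_card_le [Finite V] (hL : IsCutLattice E s t lam L)
    (P : Labelling E lam (tightSets E lam L)) (hw : ∀ x, 0 ≤ w x) (n : ℕ) :
    ∀ lo ∈ tightSets E lam L, ∀ hi ∈ tightSets E lam L, lo ⊆ hi → (pattern P lo hi).card ≤ n →
      Killable E s t lam L k w ((roundFactor lam k : ℝ) ^ n) lo hi := by
  have hw0 : ∀ S' : Finset ι, 0 ≤ ∑ x ∈ S', w x := fun S' => Finset.sum_nonneg fun x _ => hw x
  induction n with
  | zero =>
    intro lo hlo hi hhi hsub hcard X S hX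
    have hS : S = ∅ := Finset.eq_empty_of_forall_notMem fun x hx =>
      ((hX x hx).pattern_nonempty hlo hhi).ne_empty (Finset.card_eq_zero.1 (Nat.le_zero.1 hcard))
    exact ⟨∅, by simp, kills_empty hL X, by simp [hS]⟩
  | succ n ihn =>
    intro lo hlo hi hhi hsub hcard X S hX
    have ih : ∀ lo' ∈ box E lam L lo hi, ∀ hi' ∈ box E lam L lo' hi,
        pattern P lo' hi' ⊂ pattern P lo hi →
          Killable E s t lam L k w ((roundFactor lam k : ℝ) ^ n) lo' hi' :=
      fun lo' hlo' hi' hhi' hss => ihn lo' hlo'.1 hi' hhi'.1 hhi'.2.1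
        (Nat.le_of_lt_succ ((Finset.card_lt_card hss).trans_le hcard))
    have hK : (1 : ℝ) ≤ (roundFactor lam k : ℝ) ^ n :=
      one_le_pow₀ (by exact_mod_cast one_le_roundFactor lam k)
    rcases S.eq_empty_or_nonempty with rfl | ⟨x₀, hx₀⟩
    · exact ⟨∅, subset_rfl, kills_empty hL X, by simp⟩
    set B := touched E s t (tightSets E lam L) with hB
    obtain ⟨c, hc0, hmono, hc, ⟨N, hN⟩, htight, hmin⟩ :=
      exists_blocks (P := P) hL hlo hhi hsub ((hX x₀ hx₀).pattern_nonempty hlo hhi)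
    -- canonical sets taking only extreme positions
    have hmixed : ∀ I : Finset (Fin lam), ∃ W ∈ box E lam L lo hi,
        (∃ W' ∈ box E lam L lo hi, ∀ i, P.pos i W' = if i ∈ I then P.pos i hi else P.pos i lo) →
          ∀ i, P.pos i W = if i ∈ I then P.pos i hi else P.pos i lo := by
      intro I
      by_cases h : ∃ W' ∈ box E lam L lo hi,
          ∀ i, P.pos i W' = if i ∈ I then P.pos i hi else P.pos i lo
      · obtain ⟨W, hW, hWpos⟩ := h
        exact ⟨W, hW, fun _ => hWpos⟩
      · exact ⟨lo, ⟨hlo, subset_rfl, hsub⟩, fun h' => absurd h' h⟩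
    choose F hF hFpos using hmixed
    set g : ι → ℕ := fun x => Nat.findGreatest (fun a => c a ∩ B ⊆ X x) N with hg
    have hg1 : ∀ x ∈ S, c (g x) ∩ B ⊆ X x := fun x hx =>
      Nat.findGreatest_spec (P := fun a => c a ∩ B ⊆ X x) (Nat.zero_le N)
        (by rw [hc0]; exact Set.inter_subset_left.trans (hX x hx).lo_subset)
    have hNX : ∀ x ∈ S, ¬ c N ∩ B ⊆ X x := fun x hx h => by
      refine (hX x hx).not_subset hi ⟨hhi, hsub, subset_rfl⟩ fun e he => ?_
      have he' := mem_deltaPlus.1 he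
      rw [hN] at h
      exact mem_deltaPlus.2 ⟨he'.1, h ⟨he'.2.1, Or.inr (Or.inr ⟨hi, hhi, e, he, Or.inl rfl⟩)⟩,
        fun h' => he'.2.2 ((hX x hx).subset_hi h')⟩
    have hg2 : ∀ x ∈ S, ∀ a, g x < a → ¬ c a ∩ B ⊆ X x := by
      intro x hx a ha h
      rcases le_or_gt a N with haN | haN
      · exact Nat.findGreatest_is_greatest (P := fun a => c a ∩ B ⊆ X x) ha haN h
      · exact hNX x hx ((Set.inter_subset_inter_left _ (hmono haN.le)).trans h)
    have hclass : ∀ x ∈ S, ∃ o : (Finset (Fin lam) × Bool) ⊕ (Fin (2 * k + 1) × Fin lam),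
        o.elim
          (fun p => (∃ i, P.pos i (F p.1) ≠ P.pos i lo) ∧ (∃ i, P.pos i (F p.1) ≠ P.pos i hi) ∧
            (∀ i, P.pos i (F p.1) = P.pos i hi ∨ P.pos i (F p.1) = P.pos i lo) ∧
            if p.2 then Fit E s t lam L k lo (F p.1) (X x ∩ F p.1)
              else Fit E s t lam L k (F p.1) hi (X x ∪ F p.1))
          fun p => X x ∩ B ⊆ c (g x + (2 * k + 1)) ∧ g x % (2 * k + 1) = p.1 ∧
            (P.ed p.2 (c (g x + 1))).1 ∉ X x := by
      intro x hx
      have hx' := hX x hx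
      by_cases hend : X x ∩ B ⊆ c (g x + (2 * k + 1))
      · have : ∃ i, (P.ed i (c (g x + 1))).1 ∉ X x := by
          by_contra! h
          refine hg2 x hx (g x + 1) (Nat.lt_succ_self _)
            (hx'.subset_of_fst _ (hc _) fun e he => ?_)
          obtain ⟨i, rfl⟩ := Labelling.exists_ed_eq (P := P) (hc _).1 he
          exact h i
        obtain ⟨i, hi1⟩ := this
        exact ⟨Sum.inr (⟨g x % (2 * k + 1), Nat.mod_lt _ (Nat.succ_pos _)⟩, i), hend, rfl, hi1⟩
      · obtain ⟨a, ha1, ha2, hclean⟩ := hx'.exists_clean (P := P) hL hmono hc (g x)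
        have hne : c (a + 1) ≠ hi := fun h => by
          refine hend (Set.inter_subset_left.trans (hx'.subset_hi.trans ?_))
          rw [← h]
          exact hmono (by omega)
        have hbox : c (a + 1) ∈ box E lam L (c a) hi :=
          ⟨(hc _).1, hmono (Nat.le_succ a), (hc _).2.2⟩
        obtain ⟨I, hI, hsw⟩ := hclean.exists_sandwich hL hlo hhi hx' (hc a) hbox
          ((htight a).resolve_right hne)
        have hpos := hFpos I hI
        obtain ⟨hsw1, hsw2⟩ := hsw (F I) (hF I) hpos
        have hne1 : ∃ i, P.pos i (F I) ≠ P.pos i lo := by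
          by_contra! h
          refine hend fun v hv => ?_
          rcases hsw2 hv with h' | h'
          · exact hmono (by omega) h'
          · have := Labelling.inter_touched_subset (P := P) hL (hF I).1 hlo (fun i => (h i).le)
              ⟨h', hv.2⟩
            exact (hc _).2.1 this
        have hne2 : ∃ i, P.pos i (F I) ≠ P.pos i hi := by
          by_contra! h
          refine hg2 x hx (a + 1) (by omega) fun v hv => hsw1 ⟨⟨hv.1, ?_⟩, hv.2⟩
          exact Labelling.inter_touched_subset (P := P) hL hhi (hF I).1 (fun i => (h i).ge)
            ⟨(hc _).2.2 hv.1, hv.2⟩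
        have hmix : ∀ i, P.pos i (F I) = P.pos i hi ∨ P.pos i (F I) = P.pos i lo := fun i => by
          have := hpos i
          split_ifs at this
          exacts [Or.inl this, Or.inr this]
        have hswa : Sandwich B (X x) (c a) (F I) :=
          ⟨(Set.inter_subset_inter_left _ (Set.inter_subset_inter_left _
            (hmono (Nat.le_succ a)))).trans hsw1, hsw2⟩
        rcases hx'.inter_or_union hL P hlo hhi (hc a) (hF I) hmix hswa with h | h
        · exact ⟨Sum.inl (I, true), hne1, hne2, hmix, h⟩
        · exact ⟨Sum.inl (I, false), hne1, hne2, hmix, h⟩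
    have : Nonempty ((Finset (Fin lam) × Bool) ⊕ (Fin (2 * k + 1) × Fin lam)) :=
      ⟨Sum.inl (∅, true)⟩
    obtain ⟨o, S₁, hS₁, ho, hwS⟩ := exists_heavy_class hw S _ hclass
    have hcardκ : Fintype.card ((Finset (Fin lam) × Bool) ⊕ (Fin (2 * k + 1) × Fin lam)) *
        (lam + 1) = roundFactor lam k := by
      simp [roundFactor]
    suffices h : ∃ S' ⊆ S₁, Kills B (tightSets E lam L) X S' ∧ ∑ x ∈ S₁, w x ≤
        ((lam + 1 : ℕ) : ℝ) * (roundFactor lam k : ℝ) ^ n * ∑ x ∈ S', w x by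
      obtain ⟨S', hS', hkill, hwS'⟩ := h
      refine ⟨S', hS'.trans hS₁, hkill, hwS.trans ?_⟩
      calc _ ≤ _ := mul_le_mul_of_nonneg_left hwS' (Nat.cast_nonneg _)
        _ = _ := by
          rw [← hcardκ]
          push_cast
          ring
    have hweak : ∀ S' : Finset ι,
        ∑ x ∈ S₁, w x ≤ (roundFactor lam k : ℝ) ^ n * ∑ x ∈ S', w x →
        ∑ x ∈ S₁, w x ≤ ((lam + 1 : ℕ) : ℝ) * (roundFactor lam k : ℝ) ^ n * ∑ x ∈ S', w x := by
      intro S' h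
      refine h.trans (mul_le_mul_of_nonneg_right ?_ (hw0 _))
      refine le_mul_of_one_le_left (zero_le_one.trans hK) ?_
      exact_mod_cast Nat.succ_pos lam
    rcases S₁.eq_empty_or_nonempty with rfl | ⟨x₁, hx₁⟩
    · exact ⟨∅, subset_rfl, kills_empty hL X, by simp⟩
    rcases o with ⟨I, b⟩ | ⟨r, i⟩
    · obtain ⟨⟨i₁, hi₁⟩, ⟨i₂, hi₂⟩, hmix, -⟩ := ho x₁ hx₁
      have hlob : lo ∈ box E lam L lo hi := ⟨hlo, subset_rfl, hsub⟩
      have hhib : ∀ Y ∈ box E lam L lo hi, hi ∈ box E lam L Y hi :=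
        fun Y hY => ⟨hhi, hY.2.2, subset_rfl⟩
      have hle := fun i => Labelling.pos_mono (P := P) hlo hhi hsub i
      simp only at hi₁ hi₂ hmix
      cases b with
      | true =>
        have hss : pattern P lo (F I) ⊂ pattern P lo hi := by
          refine (pattern_mono hL hlo hhi hlob (hF I)).ssubset_of_ne fun h => ?_
          have h1 := (diag_mem_pattern (P := P) (i := i₂) hhi hsub).2 (by
            have := hle i₂
            have := hmix i₂
            omega)
          rw [← h, diag_mem_pattern (hF I).1 (hF I).2.1] at h1
          have := hmix i₂
          omega
        obtain ⟨S', hS', hkill, hwS'⟩ :=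
          ih lo hlob (F I) (hF I) hss (fun x => (X x ∪ lo) ∩ F I) S₁ fun x hx => by
            rw [Set.union_eq_self_of_subset_right (hX x (hS₁ hx)).lo_subset]
            exact (ho x hx).2.2.2
        exact ⟨S', hS', hkill.of_clip hL hlo (hF I).1 source_mem_touched sink_mem_touched,
          hweak S' hwS'⟩
      | false =>
        have hss : pattern P (F I) hi ⊂ pattern P lo hi := by
          refine (pattern_mono hL hlo hhi (hF I) (hhib _ (hF I))).ssubset_of_ne fun h => ?_
          have h1 := (diag_mem_pattern (P := P) (i := i₁) hhi hsub).2 (by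
            have := hle i₁
            have := hmix i₁
            omega)
          rw [← h, diag_mem_pattern hhi (hF I).2.2] at h1
          have := hmix i₁
          omega
        obtain ⟨S', hS', hkill, hwS'⟩ :=
          ih (F I) (hF I) hi (hhib _ (hF I)) hss (fun x => (X x ∪ F I) ∩ hi) S₁ fun x hx => by
            have h1 := (ho x hx).2.2.2
            simp only [Bool.false_eq_true, if_false] at h1
            rwa [Set.inter_eq_self_of_subset_left h1.subset_hi]
        exact ⟨S', hS', hkill.of_clip hL (hF I).1 hhi source_mem_touched sink_mem_touched,
          hweak S' hwS'⟩
    · refine exists_kills_of_layers hL source_mem_touched sink_mem_touched g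
        (fun x hx y hy hxy => ?_) fun a => ?_
      · obtain ⟨h1, h2, -⟩ := ho x hx
        obtain ⟨-, h4, -⟩ := ho y hy
        have h5 : g x + (2 * k + 1) ≤ g y := by
          have h6 := Nat.div_add_mod (g x) (2 * k + 1)
          have h7 := Nat.div_add_mod (g y) (2 * k + 1)
          rw [h2] at h6
          rw [h4] at h7
          have h8 : g x / (2 * k + 1) < g y / (2 * k + 1) := by
            by_contra! h
            have := Nat.mul_le_mul_left (2 * k + 1) h
            omega
          have := Nat.mul_le_mul_left (2 * k + 1) (Nat.succ_le_of_lt h8)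
          rw [Nat.mul_succ] at this
          omega
        exact fun v hv => hg1 y (hS₁ hy) ⟨hmono h5 (h1 hv), hv.2⟩
      · have hmem : ∀ x ∈ S₁.filter (fun x => g x = a), x ∈ S₁ ∧ g x = a :=
          fun x hx => Finset.mem_filter.1 hx
        refine exists_kills_layer (P := P) (i := i) hL hw hlo hhi (hc a)
          (Z := c (a + 1)) ⟨(hc _).1, hmono (Nat.le_succ a), (hc _).2.2⟩ (hmin a) hK ih
          (fun x hx => hX x (hS₁ (hmem x hx).1)) (fun x hx => ?_) fun x hx => ?_
        · obtain ⟨h1, h2⟩ := hmem x hx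
          rw [← h2]
          exact hg1 x (hS₁ h1)
        · obtain ⟨h1, h2⟩ := hmem x hx
          rw [← h2]
          exact (ho x h1).2.2

end Killable

/-! ### Source sides of minimal cuts -/

/-- The properties used of the source side `X` of a minimal cut: it is reachable from `s` within
itself, and its boundary is a minimal cut. -/
structure IsCutSide (E : Finset (V × V)) (s t : V) (X : Set V) : Prop where
  source_mem : s ∈ X
  sink_notMem : t ∉ X
  subset_of_snd : ∀ Y : Set V, s ∈ Y → (∀ e ∈ deltaPlus E Y, e.2 ∉ X) → X ⊆ Y
  subset_of_subset : ∀ Y : Set V, s ∈ Y → t ∉ Y → deltaPlus E Y ⊆ deltaPlus E X →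
    deltaPlus E X ⊆ deltaPlus E Y

theorem mem_of_reach {A : Set (V × V)} {T : Set V} {u v : V}
    (hT : ∀ a b, (a, b) ∈ A → a ∈ T → b ∈ T) (h : Reach A u v) (hu : u ∈ T) : v ∈ T := by
  induction h with
  | refl => exact hu
  | tail _ hab ih => exact hT _ _ hab ih

theorem isCut_deltaPlus {E : Finset (V × V)} {s t : V} {X : Set V} (hs : s ∈ X) (ht : t ∉ X) :
    IsCut E s t (deltaPlus E X) := by
  refine ⟨Finset.filter_subset _ _, fun h => ht (mem_of_reach ?_ h hs)⟩
  rintro a b ⟨hE, hZ⟩ ha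
  by_contra hb
  exact hZ (mem_deltaPlus.2 ⟨hE, ha, hb⟩)

section MinimalCut

variable {E Z : Finset (V × V)} {s t : V}

theorem IsMinimalCut.deltaPlus_sSide (hZ : IsMinimalCut E s t Z) :
    deltaPlus E (sSide E s Z) = Z := by
  have hsub : deltaPlus E (sSide E s Z) ⊆ Z := by
    rintro ⟨u, v⟩ he
    obtain ⟨hE, hu, hv⟩ := mem_deltaPlus.1 he
    by_contra h
    exact hv (Relation.ReflTransGen.tail hu ⟨hE, h⟩)
  by_contra hne
  exact hZ.2 _ (hsub.ssubset_of_ne hne) (isCut_deltaPlus Relation.ReflTransGen.refl hZ.1.2)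

theorem IsMinimalCut.isCutSide (hZ : IsMinimalCut E s t Z) : IsCutSide E s t (sSide E s Z) where
  source_mem := Relation.ReflTransGen.refl
  sink_notMem := hZ.1.2
  subset_of_snd Y hs h v hv := by
    refine (mem_of_reach (T := {v | v ∈ sSide E s Z ∧ v ∈ Y}) ?_ hv
      ⟨Relation.ReflTransGen.refl, hs⟩).2
    rintro a b hab ⟨ha, haY⟩
    have hb : b ∈ sSide E s Z := Relation.ReflTransGen.tail ha hab
    refine ⟨hb, ?_⟩
    by_contra hbY
    exact h (a, b) (mem_deltaPlus.2 ⟨hab.1, haY, hbY⟩) hb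
  subset_of_subset Y hs ht h := by
    rw [hZ.deltaPlus_sSide] at h ⊢
    by_contra hne
    exact hZ.2 _ ⟨h, hne⟩ (isCut_deltaPlus hs ht)

end MinimalCut

section Step

variable {E : Finset (V × V)} {s t : V} {lam k : ℕ} {L : Set (Set V)} {X Y : Set V}

/-- If a cut side `X` contains the tails of all arcs leaving the tight set `Y`, then the same arcs
leave `X ∩ Y`. -/
theorem IsCutSide.inter_mem_tightSets (hL : IsCutLattice E s t lam L) (hX : IsCutSide E s t X)
    (hXL : X ∈ L) (hY : Y ∈ tightSets E lam L) (h : ∀ e ∈ deltaPlus E Y, e.1 ∈ X) :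
    X ∩ Y ∈ tightSets E lam L ∧ deltaPlus E Y ⊆ deltaPlus E (X ∩ Y) := by
  have hUL := hL.union_mem _ hXL _ hY.1
  have hU : deltaPlus E X ⊆ deltaPlus E (X ∪ Y) := by
    refine hX.subset_of_subset _ (hL.source_mem _ hUL) (hL.sink_notMem _ hUL) fun e he => ?_
    obtain ⟨hE, h1, h2⟩ := mem_deltaPlus.1 he
    refine mem_deltaPlus.2 ⟨hE, h1.elim id fun h3 => ?_, fun h3 => h2 (Or.inl h3)⟩
    exact h e (mem_deltaPlus.2 ⟨hE, h3, fun h4 => h2 (Or.inr h4)⟩)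
  refine ⟨⟨hL.inter_mem _ hXL _ hY.1, ?_⟩, fun e he => ?_⟩
  · have h1 := Finset.card_le_card hU
    have h2 := card_deltaPlus_submodular E X Y
    have h3 := hL.le_card _ (hL.inter_mem _ hXL _ hY.1)
    have h4 := hY.2
    omega
  · obtain ⟨hE, h1, h2⟩ := mem_deltaPlus.1 he
    exact mem_deltaPlus.2 ⟨hE, ⟨h e he, h1⟩, fun h3 => h2 h3.2⟩

theorem IsCutSide.fit (hL : IsCutLattice E s t lam L) (P : Labelling E lam (tightSets E lam L))
    (hX : IsCutSide E s t X) (hXL : X ∈ L) (hk : (deltaPlus E X).card ≤ k)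
    (hlam : lam < (deltaPlus E X).card) {lo hi : Set V} (hlo : lo ⊆ X) (hhi : X ⊆ hi) :
    Fit E s t lam L k lo hi X where
  mem := hXL
  lo_subset := hlo
  subset_hi := hhi
  card_le := hk
  not_subset Y hY h := by
    have h1 := Finset.card_le_card
      (hX.subset_of_subset Y (hL.source_mem _ hY.1.1) (hL.sink_notMem _ hY.1.1) h)
    have h2 := hY.1.2
    omega
  subset_of_snd Y hY h :=
    Set.inter_subset_left.trans (hX.subset_of_snd Y (hL.source_mem _ hY.1.1) h)
  subset_of_fst Y hY h := by
    obtain ⟨h1, h2⟩ := hX.inter_mem_tightSets hL hXL hY.1 h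
    refine (Labelling.inter_touched_subset (P := P) hL hY.1 h1 fun i => ?_).trans
      Set.inter_subset_left
    exact (Labelling.ed_fst_mem hY.1 h1).1 (mem_deltaPlus.1 (h2 (Labelling.ed_mem hY.1 i))).2.1

theorem exists_kills_of_isCutSide [Finite V] (hL : IsCutLattice E s t lam L)
    (hne : (tightSets E lam L).Nonempty) {ι : Type*} {w : ι → ℝ} (hw : ∀ x, 0 ≤ w x)
    {X : ι → Set V} {S : Finset ι} (hXL : ∀ x ∈ S, X x ∈ L)
    (hX : ∀ x ∈ S, IsCutSide E s t (X x)) (hk : ∀ x ∈ S, (deltaPlus E (X x)).card ≤ k)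
    (hlam : ∀ x ∈ S, lam < (deltaPlus E (X x)).card) :
    ∃ S' ⊆ S, Kills (touched E s t (tightSets E lam L)) (tightSets E lam L) X S' ∧
      ∑ x ∈ S, w x ≤ ((lam + 1) * (lam + 1) * roundFactor lam k ^ (lam * lam) : ℕ) *
        ∑ x ∈ S', w x := by
  obtain ⟨lo, hlo, hleast⟩ := hL.exists_least hne
  obtain ⟨hi, hhi, hgreatest⟩ := hL.exists_greatest hne
  obtain ⟨P⟩ := hL.nonempty_labelling hne
  have hclass : ∀ x ∈ S, ∃ o : Option (Fin lam) × Option (Fin lam),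
      (o.1.elim (lo ⊆ X x) fun j => (P.ed j lo).1 ∉ X x) ∧
        o.2.elim (X x ⊆ hi) fun j => (P.ed j hi).2 ∈ X x := by
    intro x hx
    have h1 : ∃ o : Option (Fin lam), o.elim (lo ⊆ X x) fun j => (P.ed j lo).1 ∉ X x := by
      by_cases h : ∃ j, (P.ed j lo).1 ∉ X x
      · obtain ⟨j, hj⟩ := h
        exact ⟨some j, hj⟩
      · push Not at h
        refine ⟨none, (hleast _ ((hX x hx).inter_mem_tightSets hL (hXL x hx) hlo
          fun e he => ?_).1).trans Set.inter_subset_left⟩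
        obtain ⟨j, rfl⟩ := Labelling.exists_ed_eq (P := P) hlo he
        exact h j
    have h2 : ∃ o : Option (Fin lam), o.elim (X x ⊆ hi) fun j => (P.ed j hi).2 ∈ X x := by
      by_cases h : ∃ j, (P.ed j hi).2 ∈ X x
      · obtain ⟨j, hj⟩ := h
        exact ⟨some j, hj⟩
      · push Not at h
        refine ⟨none, (hX x hx).subset_of_snd hi (hL.source_mem _ hhi.1) fun e he => ?_⟩
        obtain ⟨j, rfl⟩ := Labelling.exists_ed_eq (P := P) hhi he
        exact h j
    obtain ⟨o₁, h1⟩ := h1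
    obtain ⟨o₂, h2⟩ := h2
    exact ⟨(o₁, o₂), h1, h2⟩
  obtain ⟨⟨o₁, o₂⟩, S₁, hS₁, ho, hwS⟩ := exists_heavy_class hw S _ hclass
  suffices h : ∃ S' ⊆ S₁, Kills (touched E s t (tightSets E lam L)) (tightSets E lam L) X S' ∧
      ∑ x ∈ S₁, w x ≤ (roundFactor lam k : ℝ) ^ (lam * lam) * ∑ x ∈ S', w x by
    obtain ⟨S', hS', hkill, hwS'⟩ := h
    refine ⟨S', hS'.trans hS₁, hkill, hwS.trans
      ((mul_le_mul_of_nonneg_left hwS' (Nat.cast_nonneg _)).trans_eq ?_)⟩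
    simp [mul_assoc]
  have hweak : ∑ x ∈ S₁, w x ≤ (roundFactor lam k : ℝ) ^ (lam * lam) * ∑ x ∈ S₁, w x :=
    le_mul_of_one_le_left (Finset.sum_nonneg fun x _ => hw x)
      (one_le_pow₀ (by exact_mod_cast one_le_roundFactor lam k))
  rcases o₁ with - | j
  · rcases o₂ with - | j
    · refine killable_of_pattern_card_le hL P hw _ lo hlo hi hhi (hleast _ hhi) ?_ X S₁
        fun x hx => (hX x (hS₁ hx)).fit hL P (hXL x (hS₁ hx)) (hk x (hS₁ hx))
          (hlam x (hS₁ hx)) (ho x hx).1 (ho x hx).2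
      exact (Finset.card_le_univ _).trans (by simp)
    · refine ⟨S₁, subset_rfl, fun T hT hg => ?_, hweak⟩
      have h1 := hg.lt_pos hL hT hhi fun x hx => (ho x hx).2
      exact h1.not_ge (Labelling.pos_mono hT hhi (hgreatest T hT) j)
  · refine ⟨S₁, subset_rfl, fun T hT hg => ?_, hweak⟩
    have h1 := hg.pos_lt hL hT hlo fun x hx => (ho x hx).1
    exact h1.not_ge (Labelling.pos_mono hlo hT (hleast T hT) j)

end Step

/-! ### Iterating over the cut sizes -/

section Iteration

variable {ι : Type*} {X : ι → Set V} {S : Finset ι} {T T' : Set V}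

theorem isGenerated_of_mem {B : Set V} {x : ι} (hx : x ∈ S) : IsGenerated B X S (X x) :=
  fun _ hu _ _ _ hv => ⟨x, hx, hu, hv⟩

theorem IsGenerated.inter {B : Set V} (h : IsGenerated B X S T) (h' : IsGenerated B X S T') :
    IsGenerated B X S (T ∩ T') := fun u hu huB v hvB hv => by
  by_cases hvT : v ∈ T
  · exact h' u hu.2 huB v hvB fun hvT' => hv ⟨hvT, hvT'⟩
  · exact h u hu.1 huB v hvB hvT

theorem IsGenerated.union {B : Set V} (h : IsGenerated B X S T) (h' : IsGenerated B X S T') :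
    IsGenerated B X S (T ∪ T') := fun u hu huB v hvB hv =>
  hu.elim (fun hu => h u hu huB v hvB fun h1 => hv (Or.inl h1))
    fun hu => h' u hu huB v hvB fun h1 => hv (Or.inr h1)

theorem IsGenerated.mono_left {B B' : Set V} (h : IsGenerated B' X S T) (hB : B ⊆ B') :
    IsGenerated B X S T := fun u hu huB v hvB hv => h u hu (hB huB) v (hB hvB) hv

/-- The sets separating `s` from `t` generated by a family. -/
def generatedCuts (s t : V) (X : ι → Set V) (S : Finset ι) : Set (Set V) :=
  {T | IsGenerated Set.univ X S T ∧ s ∈ T ∧ t ∉ T}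

/-- The loss in one step of the iteration. -/
def stepFactor (k : ℕ) : ℕ := (k + 1) * (k + 1) * roundFactor k k ^ (k * k)

theorem one_le_stepFactor (k : ℕ) : 1 ≤ stepFactor k :=
  Nat.one_le_iff_ne_zero.2 (Nat.mul_ne_zero (by positivity)
    (pow_ne_zero _ (Nat.one_le_iff_ne_zero.1 (one_le_roundFactor k k))))

theorem step_le_stepFactor {lam k : ℕ} (h : lam ≤ k) :
    (lam + 1) * (lam + 1) * roundFactor lam k ^ (lam * lam) ≤ stepFactor k := by
  have h1 : roundFactor lam k ≤ roundFactor k k := by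
    unfold roundFactor
    gcongr
    norm_num
  unfold stepFactor
  calc _ ≤ (k + 1) * (k + 1) * roundFactor k k ^ (lam * lam) := by gcongr
    _ ≤ _ := by
      refine Nat.mul_le_mul_left _ (Nat.pow_le_pow_right (one_le_roundFactor k k) ?_)
      gcongr

/-- A weighted family of cut sides with `m` leaving arcs has a heavy subfamily all of whose
generated cuts have at least `m` leaving arcs. -/
theorem exists_generatedCuts_card_le [Finite V] {E : Finset (V × V)} {s t : V} {m k : ℕ}
    (hmk : m ≤ k) {w : ι → ℝ} (hw : ∀ x, 0 ≤ w x) (n : ℕ) :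
    ∀ S : Finset ι, (∀ x ∈ S, IsCutSide E s t (X x)) →
      (∀ x ∈ S, (deltaPlus E (X x)).card = m) →
      (∀ T ∈ generatedCuts s t X S, m ≤ (deltaPlus E T).card + n) →
      ∃ S' ⊆ S, (∀ T ∈ generatedCuts s t X S', m ≤ (deltaPlus E T).card) ∧
        ∑ x ∈ S, w x ≤ (stepFactor k : ℝ) ^ n * ∑ x ∈ S', w x := by
  have hw0 : ∀ S' : Finset ι, 0 ≤ ∑ x ∈ S', w x := fun S' => Finset.sum_nonneg fun x _ => hw x
  have hK : (1 : ℝ) ≤ stepFactor k := by exact_mod_cast one_le_stepFactor k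
  induction n with
  | zero => exact fun S _ _ h => ⟨S, subset_rfl, h, by simp⟩
  | succ n ih =>
    intro S hX hm hS
    by_cases hgood : ∀ T ∈ generatedCuts s t X S, m ≤ (deltaPlus E T).card + n
    · obtain ⟨S', hS', h1, h2⟩ := ih S hX hm hgood
      exact ⟨S', hS', h1, h2.trans (mul_le_mul_of_nonneg_right
        (pow_le_pow_right₀ hK (Nat.le_succ n)) (hw0 _))⟩
    push Not at hgood
    obtain ⟨T₀, hT₀, hT₀m⟩ := hgood
    obtain ⟨lam, hlam⟩ : ∃ lam, lam + (n + 1) = m := ⟨m - (n + 1), by omega⟩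
    have hL : IsCutLattice E s t lam (generatedCuts s t X S) :=
      { inter_mem := fun T hT T' hT' => ⟨hT.1.inter hT'.1, ⟨hT.2.1, hT'.2.1⟩, fun h => hT.2.2 h.1⟩
        union_mem := fun T hT T' hT' => ⟨hT.1.union hT'.1, Or.inl hT.2.1,
          fun h => h.elim hT.2.2 hT'.2.2⟩
        source_mem := fun T hT => hT.2.1
        sink_notMem := fun T hT => hT.2.2
        le_card := fun T hT => by
          have := hS T hT
          omega }
    have hne : (tightSets E lam (generatedCuts s t X S)).Nonempty :=
      ⟨T₀, hT₀, by have := hS T₀ hT₀; omega⟩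
    obtain ⟨S₁, hS₁, hkill, hwS⟩ := exists_kills_of_isCutSide (k := k) hL hne hw
      (fun x hx => ⟨isGenerated_of_mem hx, (hX x hx).source_mem, (hX x hx).sink_notMem⟩) hX
      (fun x hx => (hm x hx).trans_le hmk) (fun x hx => by have := hm x hx; omega)
    obtain ⟨S', hS', h1, h2⟩ := ih S₁ (fun x hx => hX x (hS₁ hx)) (fun x hx => hm x (hS₁ hx))
      fun T hT => by
        have hTS : T ∈ generatedCuts s t X S := ⟨hT.1.mono hS₁, hT.2⟩
        have h3 := hL.le_card T hTS
        have h4 : (deltaPlus E T).card ≠ lam := fun h =>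
          hkill T ⟨hTS, h⟩ (hT.1.mono_left (Set.subset_univ _))
        omega
    refine ⟨S', hS'.trans hS₁, h1, hwS.trans ?_⟩
    calc _ ≤ (stepFactor k : ℝ) * ∑ x ∈ S₁, w x :=
          mul_le_mul_of_nonneg_right
            (by exact_mod_cast step_le_stepFactor (by omega : lam ≤ k)) (hw0 _)
      _ ≤ stepFactor k * (stepFactor k ^ n * ∑ x ∈ S', w x) :=
          mul_le_mul_of_nonneg_left h2 (zero_le_one.trans hK)
      _ = _ := by ring

end Iteration

/-- The inverse of the success probability. -/
def lossFactor (k : ℕ) : ℕ := (k + 1) * stepFactor k ^ k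

theorem one_le_lossFactor (k : ℕ) : 1 ≤ lossFactor k :=
  Nat.one_le_iff_ne_zero.2 (Nat.mul_ne_zero k.succ_ne_zero
    (pow_ne_zero _ (Nat.one_le_iff_ne_zero.1 (one_le_stepFactor k))))

/-- A single augmentation handles a large fraction of the weight of any weighted family of minimal
cuts of size at most `k`. -/
theorem exists_heavy_augmentation [Fintype V] {E : Finset (V × V)} {s t : V} {k : ℕ}
    {ι : Type*} {w : ι → ℝ} (hw : ∀ x, 0 ≤ w x) (Z : ι → Finset (V × V)) (S : Finset ι)
    (hS : ∀ x ∈ S, IsMinimalCut E s t (Z x)) (hk : ∀ x ∈ S, (Z x).card ≤ k) :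
    ∃ A : Finset (V × V), ∑ x ∈ S, w x ≤
      (lossFactor k : ℝ) * ∑ x ∈ S, if IsMinCutAug E A s t (Z x) then w x else 0 := by
  have hw0 : ∀ S' : Finset ι, 0 ≤ ∑ x ∈ S', w x := fun S' => Finset.sum_nonneg fun x _ => hw x
  obtain ⟨m, S₁, hS₁, hm, hwS⟩ := exists_heavy_class hw S
    (fun x (m : Fin (k + 1)) => (Z x).card = m)
    fun x hx => ⟨⟨(Z x).card, Nat.lt_succ_of_le (hk x hx)⟩, rfl⟩
  have hdelta : ∀ x ∈ S₁, deltaPlus E (sSide E s (Z x)) = Z x :=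
    fun x hx => (hS x (hS₁ hx)).deltaPlus_sSide
  obtain ⟨S', hS', hgen, hwS'⟩ := exists_generatedCuts_card_le (X := fun x => sSide E s (Z x))
    (E := E) (s := s) (t := t) (Nat.lt_succ_iff.1 m.2) hw m S₁
    (fun x hx => (hS x (hS₁ hx)).isCutSide)
    (fun x hx => by rw [hdelta x hx, hm x hx]) fun T _ => Nat.le_add_left _ _
  set A : Finset (V × V) := Finset.univ.filter fun e =>
    ∀ x ∈ S', e.1 ∈ sSide E s (Z x) → e.2 ∈ sSide E s (Z x)
  have hgood : ∀ x ∈ S', IsMinCutAug E A s t (Z x) := by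
    intro x hx
    have hZ := hS x (hS₁ (hS' hx))
    refine ⟨⟨hZ.1.1, fun h => hZ.1.2
      (mem_of_reach (T := sSide E s (Z x)) ?_ h Relation.ReflTransGen.refl)⟩, fun Z' hZ' => ?_⟩
    · rintro a b (hab | hab) ha
      · exact Relation.ReflTransGen.tail ha hab
      · exact (Finset.mem_filter.1 hab).2 x hx ha
    · set T : Set V :=
        {v | Reach (((E : Set (V × V)) \ (Z' : Set (V × V))) ∪ (A : Set (V × V))) s v}
      have hTgen : T ∈ generatedCuts s t (fun x => sSide E s (Z x)) S' := by
        refine ⟨fun u hu _ v _ hv => ?_, Relation.ReflTransGen.refl, hZ'.2⟩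
        by_contra! h
        exact hv (Relation.ReflTransGen.tail hu
          (Or.inr (Finset.mem_coe.2 (Finset.mem_filter.2 ⟨Finset.mem_univ _, h⟩))))
      have hTZ : deltaPlus E T ⊆ Z' := by
        rintro ⟨u, v⟩ he
        obtain ⟨hE, hu, hv⟩ := mem_deltaPlus.1 he
        by_contra h
        exact hv (Relation.ReflTransGen.tail hu (Or.inl ⟨hE, h⟩))
      rw [hm x (hS' hx)]
      exact (hgen T hTgen).trans (Finset.card_le_card hTZ)
  refine ⟨A, hwS.trans ?_⟩
  have hK : (1 : ℝ) ≤ stepFactor k := by exact_mod_cast one_le_stepFactor k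
  have hsub : S' ⊆ S.filter fun x => IsMinCutAug E A s t (Z x) := fun x hx =>
    Finset.mem_filter.2 ⟨hS₁ (hS' hx), hgood x hx⟩
  rw [← Finset.sum_filter]
  calc _ ≤ ((k + 1 : ℕ) : ℝ) * (stepFactor k ^ k *
        ∑ x ∈ S.filter fun x => IsMinCutAug E A s t (Z x), w x) := by
        rw [Fintype.card_fin]
        refine mul_le_mul_of_nonneg_left (hwS'.trans ?_) (Nat.cast_nonneg _)
        refine mul_le_mul (pow_le_pow_right₀ hK (Nat.lt_succ_iff.1 m.2)) ?_ (hw0 _) (by positivity)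
        exact Finset.sum_le_sum_of_subset_of_nonneg hsub fun x _ _ => hw x
    _ = _ := by
      rw [lossFactor]
      push_cast
      ring

/-! ### From weights to distributions -/

/-- A form of the minimax theorem: if every weighting of the rows has a column covering a fraction
`1 / K` of the weight, some distribution on the columns covers each row with probability at least
`1 / K`. -/
theorem exists_distribution {α β : Type*} [Fintype α] [Fintype β] (R : α → β → Prop) {K : ℝ}
    (hK : 0 < K)
    (h : ∀ w : β → ℝ, (∀ z, 0 ≤ w z) → ∃ a, ∑ z, w z ≤ K * ∑ z, if R a z then w z else 0) :
    ∃ D ∈ stdSimplex ℝ α, ∀ z, K⁻¹ ≤ ∑ a, if R a z then D a else 0 := by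
  set Φ : (α → ℝ) → β → ℝ := fun D z => ∑ a, if R a z then D a else 0 with hΦ
  have hΦcont : Continuous Φ := by
    refine continuous_pi fun z => continuous_finsetSum _ fun a _ => ?_
    split_ifs
    exacts [continuous_apply a, continuous_const]
  have hΦlin : IsLinearMap ℝ Φ :=
    { map_add := fun D D' => by
        ext z
        simp only [hΦ, Pi.add_apply, ← Finset.sum_add_distrib]
        exact Finset.sum_congr rfl fun a _ => by split_ifs <;> simp
      map_smul := fun r D => by
        ext z
        simp [hΦ, Finset.mul_sum] }
  by_contra! hno
  have hdisj : Disjoint (Φ '' stdSimplex ℝ α) (Set.Ici fun _ => K⁻¹) := by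
    rw [Set.disjoint_left]
    rintro _ ⟨D, hD, rfl⟩ hy
    obtain ⟨z, hz⟩ := hno D hD
    exact hz.not_ge (hy z)
  obtain ⟨f, u, v, hfu, huv, hfv⟩ := geometric_hahn_banach_compact_closed
    ((convex_stdSimplex ℝ α).is_linear_image hΦlin)
    ((isCompact_stdSimplex ℝ α).image hΦcont)
    (convex_Ici _) isClosed_Ici hdisj
  have hf : ∀ y : β → ℝ, f y = ∑ z, y z * f (Pi.single z 1) := fun y => by
    have := LinearMap.pi_apply_eq_sum_univ (f : (β → ℝ) →ₗ[ℝ] ℝ) y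
    have hs : ∀ z : β, (fun j => if z = j then (1 : ℝ) else 0) = Pi.single z 1 := fun z => by
      ext j
      simp [Pi.single_apply, eq_comm]
    simpa [hs] using this
  set c : β → ℝ := fun z => f (Pi.single z 1) with hc
  have hv0 := hfv (fun _ => K⁻¹) Set.self_mem_Ici
  have hcpos : ∀ z, 0 ≤ c z := by
    intro z
    by_contra! hz
    set r : ℝ := (f (fun _ => K⁻¹) - v) / (-c z) with hr
    have hr0 : 0 ≤ r := div_nonneg (by linarith) (by linarith)
    have h1 := hfv ((fun _ => K⁻¹) + r • Pi.single z 1) fun z' => by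
      simp only [Pi.add_apply, Pi.smul_apply, smul_eq_mul]
      refine le_add_of_nonneg_right (mul_nonneg hr0 ?_)
      rw [Pi.single_apply]
      split_ifs <;> norm_num
    rw [map_add, map_smul, smul_eq_mul] at h1
    have h2 : r * c z = -(f (fun _ => K⁻¹) - v) := by
      rw [hr, div_mul_eq_mul_div, div_eq_iff (by linarith)]
      ring
    simp only [hc] at h2
    linarith
  obtain ⟨a, ha⟩ := h c hcpos
  have h1 := hfu _ ⟨Pi.single a 1, single_mem_stdSimplex ℝ a, rfl⟩
  have h2 : f (Φ (Pi.single a 1)) = ∑ z, if R a z then c z else 0 := by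
    rw [hf]
    refine Finset.sum_congr rfl fun z _ => ?_
    have : Φ (Pi.single a 1) z = if R a z then 1 else 0 := by
      simp only [hΦ, Pi.single_apply]
      rw [Finset.sum_eq_single a] <;> simp +contextual
    rw [this]
    split_ifs <;> simp [hc]
  rw [hf, ← Finset.mul_sum] at hv0
  rw [h2] at h1
  have h3 : (∑ z, if R a z then c z else 0) < K⁻¹ * ∑ z, c z := h1.trans (huv.trans hv0)
  rw [inv_mul_eq_div, lt_div_iff₀ hK] at h3
  linarith

theorem roundFactor_self_le (k : ℕ) : roundFactor k k ≤ 2 ^ (3 * k + 2) := by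
  have h1 : k + 1 ≤ 2 ^ k := Nat.lt_two_pow_self
  have h2 : 2 ^ (3 * k + 2) = 2 ^ k * 2 ^ k * 2 ^ k * 4 := by ring
  unfold roundFactor
  rw [h2]
  nlinarith [Nat.mul_le_mul h1 h1, Nat.mul_le_mul (Nat.mul_le_mul h1 h1) h1]

theorem lossFactor_le (k : ℕ) : lossFactor k ≤ 2 ^ (3 * (k + 2) ^ 4) := by
  have h1 : k + 1 ≤ 2 ^ k := Nat.lt_two_pow_self
  calc lossFactor k ≤ 2 ^ k * (2 ^ k * 2 ^ k * (2 ^ (3 * k + 2)) ^ (k * k)) ^ k := by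
        unfold lossFactor stepFactor
        gcongr
        exact roundFactor_self_le k
    _ = 2 ^ (k + (k + k + (3 * k + 2) * (k * k)) * k) := by
        simp only [← pow_add, ← pow_mul]
    _ ≤ _ := by
        refine Nat.pow_le_pow_right two_pos ?_
        ring_nf
        nlinarith [sq_nonneg k, Nat.zero_le (k ^ 3), Nat.zero_le (k ^ 4)]

theorem rpow_le_inv_lossFactor (k : ℕ) :
    (2 : ℝ) ^ (-(6 * ((k : ℝ) + 2) ^ 4 * Real.log ((k : ℝ) + 2))) ≤ (lossFactor k : ℝ)⁻¹ := by
  have hlog : (1 : ℝ) / 2 ≤ Real.log ((k : ℝ) + 2) := by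
    have h1 := Real.log_two_gt_d9
    have h2 : Real.log 2 ≤ Real.log ((k : ℝ) + 2) :=
      Real.log_le_log two_pos (by linarith [(Nat.cast_nonneg k : (0 : ℝ) ≤ k)])
    linarith
  have hexp : ((3 * (k + 2) ^ 4 : ℕ) : ℝ) ≤
      6 * ((k : ℝ) + 2) ^ 4 * Real.log ((k : ℝ) + 2) := by
    push_cast
    have : (0 : ℝ) ≤ ((k : ℝ) + 2) ^ 4 := by positivity
    nlinarith
  rw [Real.rpow_neg zero_le_two]
  refine inv_anti₀ (by exact_mod_cast one_le_lossFactor k) ?_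
  calc (lossFactor k : ℝ) ≤ (2 : ℝ) ^ (3 * (k + 2) ^ 4) := by exact_mod_cast lossFactor_le k
    _ = (2 : ℝ) ^ (((3 * (k + 2) ^ 4 : ℕ) : ℝ)) := (Real.rpow_natCast _ _).symm
    _ ≤ _ := Real.rpow_le_rpow_of_exponent_le one_le_two hexp

/-- Randomized flow-augmentation for minimal `st`-cuts (Theorem 1 / `thm:intro`). -/
theorem flow_augmentation_randomized :
    ∃ C : ℝ, 0 < C ∧
      ∀ (V : Type) [Fintype V] [DecidableEq V] (E : Finset (V × V)) (s t : V),
        s ≠ t → ∀ k : ℕ,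
          ∃ D : Finset (V × V) → ℝ,
            (∀ A, 0 ≤ D A) ∧ (∑ A : Finset (V × V), D A) = 1 ∧
            ∀ Z : Finset (V × V), IsMinimalCut E s t Z → Z.card ≤ k →
              (2 : ℝ) ^ (-(C * ((k : ℝ) + 2) ^ 4 * Real.log ((k : ℝ) + 2))) ≤
                ∑ A : Finset (V × V),
                  (if IsCutAug E A s t Z ∧ IsMinCutAug E A s t Z then D A else 0) := by
  refine ⟨6, by norm_num, fun V _ _ E s t _ k => ?_⟩
  obtain ⟨D, hD, hgood⟩ := exists_distribution
    (fun A (Z : {Z : Finset (V × V) // IsMinimalCut E s t Z ∧ Z.card ≤ k}) =>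
      IsMinCutAug E A s t Z.1) (K := lossFactor k) (by exact_mod_cast one_le_lossFactor k)
    fun w hw => exists_heavy_augmentation hw Subtype.val Finset.univ (fun Z _ => Z.2.1)
      fun Z _ => Z.2.2
  refine ⟨D, hD.1, hD.2, fun Z hZ hk => (rpow_le_inv_lossFactor k).trans
    ((hgood ⟨Z, hZ, hk⟩).trans_eq (Finset.sum_congr rfl fun A _ => ?_))⟩
  have : IsCutAug E A s t Z ∧ IsMinCutAug E A s t Z ↔ IsMinCutAug E A s t Z :=
    and_iff_right_of_imp And.left
  simp only [this]

end FlowAug
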